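/- Let J₀ : ℝ → ℝ be defined by J₀(z) = (1/π) ∫₀^π cos(z sin θ) dθ, let Y₀ : (0,∞) → ℝ be defined by Y₀(z) = −(2/π) ∫₀^∞ cos(z cosh t) dt, and set H₀⁻(z) = J₀(z) − i Y₀(z) for z > 0. Let λ₁ ∈ (0, 1/4] and let χ : ℝ → [0,1] be a smooth function with χ(λ) = 1 for 0 ≤ λ ≤ λ₁ and χ(λ) = 0 for λ ≥ 2λ₁. Let h⁻(λ) = a log λ + w with a ∈ ℝ \ {0} and w ∈ ℂ. Then for every ε ∈ (0,1) there exists a constant C (depending on χ, a, w, ε) such that for all fixed constants r, s > 0: |∫₀^∞ (H₀⁻)′(λr) · J₀′(λs) · λ³ · h⁻(λ) · χ(λ) dλ| ≤ C · [ 1/(√(rs) · ⟨r − s⟩²) + 1/(r · ⟨r + s⟩^{2+ε}) ]. -/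

import Mathlib

open MeasureTheory Real Filter

/-- The Bessel function of the first kind of order zero,
`J₀(z) = (1/π) ∫₀^π cos(z sin θ) dθ`. -/
noncomputable def J0 (z : ℝ) : ℝ :=
  (1 / Real.pi) * ∫ θ in (0:ℝ)..Real.pi, Real.cos (z * Real.sin θ)

/-- A bound for `α log + β` near the origin. -/
lemma exists_norm_mul_log_add_le {α β : ℝ → ℂ} (hα : Continuous α) (hβ : Continuous β)
    (hα0 : ∀ t, 1 < t → α t = 0) (hβ0 : ∀ t, 1 < t → β t = 0) {δ : ℝ} (hδ : 0 < δ) :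
    ∃ C : ℝ, 0 ≤ C ∧ ∀ t : ℝ, 0 < t →
      ‖α t * (Real.log t : ℂ) + β t‖ ≤ (Set.Ioc (0:ℝ) 1).indicator (fun t => C * t ^ (-δ)) t := by
  obtain ⟨A, hA⟩ := (isCompact_Icc (a := (0:ℝ)) (b := 1)).exists_bound_of_continuousOn
    hα.continuousOn
  obtain ⟨B, hB⟩ := (isCompact_Icc (a := (0:ℝ)) (b := 1)).exists_bound_of_continuousOn
    hβ.continuousOn
  have hA0 : 0 ≤ A := (norm_nonneg _).trans (hA 0 (by simp))
  have hB0 : 0 ≤ B := (norm_nonneg _).trans (hB 0 (by simp))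
  refine ⟨A * (1 / δ) + B, by positivity, fun t ht => ?_⟩
  rcases le_or_gt t 1 with h1 | h1
  · rw [Set.indicator_of_mem (show t ∈ Set.Ioc (0:ℝ) 1 from ⟨ht, h1⟩)]
    have hlog : |Real.log t| ≤ 1 / δ * t ^ (-δ) := by
      have h := (Real.abs_log_mul_self_rpow_lt t δ ht h1 hδ).le
      rw [abs_mul, abs_of_pos (rpow_pos_of_pos ht δ)] at h
      rw [rpow_neg ht.le, ← div_eq_mul_inv, le_div_iff₀ (rpow_pos_of_pos ht δ)]
      exact h
    have hone : 1 ≤ t ^ (-δ) := Real.one_le_rpow_of_pos_of_le_one_of_nonpos ht h1 (by linarith)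
    calc ‖α t * (Real.log t : ℂ) + β t‖ ≤ ‖α t‖ * |Real.log t| + ‖β t‖ := by
          refine (norm_add_le _ _).trans ?_
          rw [norm_mul, Complex.norm_real, Real.norm_eq_abs]
      _ ≤ A * (1 / δ * t ^ (-δ)) + B * t ^ (-δ) := by
          gcongr
          · exact hA t ⟨ht.le, h1⟩
          · exact (hB t ⟨ht.le, h1⟩).trans (le_mul_of_one_le_right hB0 hone)
      _ = (A * (1 / δ) + B) * t ^ (-δ) := by ring
  · rw [hα0 t h1, hβ0 t h1]
    simp only [zero_mul, add_zero, norm_zero]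
    exact Set.indicator_nonneg (fun x hx => by have := hx.1; positivity) _

lemma integrableOn_indicator_rpow (C : ℝ) {p : ℝ} (hp : -1 < p) :
    IntegrableOn ((Set.Ioc (0:ℝ) 1).indicator fun t => C * t ^ p) (Set.Ioi 0) := by
  have h : IntegrableOn (fun t : ℝ => C * t ^ p) (Set.Ioc 0 1) :=
    (((intervalIntegral.intervalIntegrable_rpow' hp (a := 0) (b := 1)).1).const_mul C)
  exact (h.integrable_indicator measurableSet_Ioc).integrableOn

lemma norm_one_sub_exp_neg_le {z : ℂ} (hz : 0 ≤ z.re) {θ : ℝ} (h0 : 0 ≤ θ) (h1 : θ ≤ 1) :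
    ‖1 - Complex.exp (-z)‖ ≤ 2 * ‖z‖ ^ θ := by
  rcases le_total ‖z‖ 1 with h | h
  · rw [norm_sub_rev]
    refine (Complex.norm_exp_sub_one_le (by rwa [norm_neg])).trans ?_
    rw [norm_neg]
    gcongr
    exact Real.self_le_rpow_of_le_one (norm_nonneg _) h h1
  · have h2 : ‖Complex.exp (-z)‖ ≤ 1 := by
      rw [Complex.norm_exp]; simpa using hz
    have h3 : 1 ≤ ‖z‖ ^ θ := Real.one_le_rpow h h0
    calc ‖1 - Complex.exp (-z)‖ ≤ ‖(1:ℂ)‖ + ‖Complex.exp (-z)‖ := norm_sub_le _ _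
      _ ≤ 2 * ‖z‖ ^ θ := by rw [norm_one]; linarith

lemma deriv_eq_zero_of_eqOn_Ioi {α : ℝ → ℂ} (hα0 : ∀ t, 1 < t → α t = 0) {t : ℝ} (ht : 1 < t) :
    deriv α t = 0 := by
  have : α =ᶠ[nhds t] fun _ => 0 := by
    filter_upwards [Ioi_mem_nhds ht] with x hx using hα0 x hx
  rw [this.deriv_eq]; simp

lemma hasDerivAt_pow_mul_log_add {α β : ℝ → ℂ} (hα : Differentiable ℝ α)
    (hβ : Differentiable ℝ β) (n : ℕ) {t : ℝ} (ht : 0 < t) :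
    HasDerivAt (fun t : ℝ => (t : ℂ) ^ n * (α t * (Real.log t : ℂ) + β t))
      ((t : ℂ) ^ n * ((t * deriv α t + n * α t) * (Real.log t : ℂ)
        + (t * deriv β t + n * β t + α t)) / t) t := by
  have h1 : HasDerivAt (fun t : ℝ => (t : ℂ) ^ n) ((n : ℂ) * (t : ℂ) ^ (n - 1)) t := by
    simpa using (hasDerivAt_pow n (t : ℂ)).comp_ofReal
  have h2 : HasDerivAt (fun t : ℝ => (Real.log t : ℂ)) ((t⁻¹ : ℝ) : ℂ) t :=
    (Real.hasDerivAt_log ht.ne').ofReal_comp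
  have h := h1.fun_mul (((hα t).hasDerivAt.fun_mul h2).fun_add (hβ t).hasDerivAt)
  refine h.congr_deriv ?_
  have htc : (t : ℂ) ≠ 0 := by exact_mod_cast ht.ne'
  rcases n with _ | n
  · push_cast; field_simp; ring
  · simp only [Nat.add_sub_cancel, pow_succ]; push_cast; field_simp; ring

/-- Integration by parts against `exp (-t ζ)`, for an antiderivative `v` of that function
which compensates the singularity at the origin. -/
lemma laplace_log_integral_by_parts {α β : ℝ → ℂ} (hα : ContDiff ℝ (⊤ : ℕ∞) α)
    (hβ : ContDiff ℝ (⊤ : ℕ∞) β) (hα0 : ∀ t, 1 < t → α t = 0) (hβ0 : ∀ t, 1 < t → β t = 0)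
    (n : ℕ) {θ : ℝ} (hθ : 0 < n + θ) :
    ∃ C : ℝ, 0 ≤ C ∧ ∀ (ζ : ℂ) (v : ℝ → ℂ) (K : ℝ), 0 ≤ ζ.re → 0 ≤ K →
      (∀ t : ℝ, HasDerivAt v (Complex.exp (-(t * ζ))) t) →
      (∀ t, 0 < t → t ≤ 1 → ‖v t‖ ≤ K * t ^ θ) →
      (∫ t in Set.Ioi (0:ℝ), Complex.exp (-(t * ζ)) *
          ((t : ℂ) ^ n * (α t * (Real.log t : ℂ) + β t))) =
        - ∫ t in Set.Ioi (0:ℝ), v t * ((t : ℂ) ^ n * ((t * deriv α t + n * α t) *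
          (Real.log t : ℂ) + (t * deriv β t + n * β t + α t)) / t) ∧
      ‖∫ t in Set.Ioi (0:ℝ), v t * ((t : ℂ) ^ n * ((t * deriv α t + n * α t) *
          (Real.log t : ℂ) + (t * deriv β t + n * β t + α t)) / t)‖ ≤ K * C := by
  have hαc := hα.continuous
  have hβc := hβ.continuous
  have hdα : Continuous (deriv α) := hα.continuous_deriv (by exact_mod_cast le_top)
  have hdβ : Continuous (deriv β) := hβ.continuous_deriv (by exact_mod_cast le_top)
  set δ := min ((n + θ) / 2) (1 / 2) with hδdef
  have hδ : 0 < δ := lt_min (by linarith) (by norm_num)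
  have hδ2 : δ ≤ (n + θ) / 2 := min_le_left _ _
  have hδ3 : δ ≤ 1 / 2 := min_le_right _ _
  obtain ⟨A, hA, hAb⟩ := exists_norm_mul_log_add_le hαc hβc hα0 hβ0 hδ
  obtain ⟨C, hC, hCb⟩ := exists_norm_mul_log_add_le
    (α := fun t => t * deriv α t + n * α t) (β := fun t => t * deriv β t + n * β t + α t)
    (by fun_prop) (by fun_prop)
    (fun t ht => by simp [hα0 t ht, deriv_eq_zero_of_eqOn_Ioi hα0 ht])
    (fun t ht => by simp [hα0 t ht, hβ0 t ht, deriv_eq_zero_of_eqOn_Ioi hβ0 ht]) hδ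
  refine ⟨∫ t in Set.Ioi (0:ℝ), (Set.Ioc (0:ℝ) 1).indicator (fun t => C * t ^ (n + θ - δ - 1)) t,
    integral_nonneg fun t => Set.indicator_nonneg (fun x hx => ?_) _, ?_⟩
  · have := hx.1; positivity
  intro ζ v K hζ hK hv hvb
  have hvc : Continuous v := continuous_iff_continuousAt.2 fun t => (hv t).continuousAt
  set g : ℝ → ℂ := fun t => (t : ℂ) ^ n * (α t * (Real.log t : ℂ) + β t) with hg
  set g' : ℝ → ℂ := fun t => (t : ℂ) ^ n * ((t * deriv α t + n * α t) *
          (Real.log t : ℂ) + (t * deriv β t + n * β t + α t)) / t with hg'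
  have hgm : Measurable g := by
    have := hαc.measurable; have := hβc.measurable; have := Real.measurable_log
    fun_prop
  have hgm' : Measurable g' := by
    have := hαc.measurable; have := hβc.measurable; have := Real.measurable_log
    have := hdα.measurable; have := hdβ.measurable
    fun_prop
  have hbound : ∀ t ∈ Set.Ioi (0:ℝ), ‖v t * g' t‖ ≤
      K * (Set.Ioc (0:ℝ) 1).indicator (fun t => C * t ^ (n + θ - δ - 1)) t := by
    intro t ht
    have ht : 0 < t := ht
    have h := hCb t ht
    by_cases h1 : t ≤ 1
    · have hm : t ∈ Set.Ioc (0:ℝ) 1 := ⟨ht, h1⟩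
      rw [Set.indicator_of_mem hm] at h ⊢
      have e : t ^ (n + θ - δ - 1) = t ^ n * t ^ θ * t ^ (-δ) / t := by
        rw [← Real.rpow_natCast t n, ← Real.rpow_add ht, ← Real.rpow_add ht, div_eq_mul_inv,
          ← Real.rpow_neg_one t, ← Real.rpow_add ht]
        ring_nf
      rw [norm_mul, hg', norm_div, norm_mul, norm_pow, Complex.norm_real, Real.norm_eq_abs,
        abs_of_pos ht, e]
      calc ‖v t‖ * (t ^ n * _ / t) ≤ (K * t ^ θ) * (t ^ n * (C * t ^ (-δ)) / t) := by
            gcongr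
            exact hvb t ht h1
        _ = _ := by ring
    · have hm : t ∉ Set.Ioc (0:ℝ) 1 := fun h => h1 h.2
      rw [Set.indicator_of_notMem hm] at h ⊢
      have : g' t = 0 := by
        have := norm_le_zero_iff.1 h
        simp only [hg', this, mul_zero, zero_div]
      simp [this]
  have hint : IntegrableOn (fun t => K *
      (Set.Ioc (0:ℝ) 1).indicator (fun t => C * t ^ (n + θ - δ - 1)) t) (Set.Ioi 0) :=
    (integrableOn_indicator_rpow C (by linarith)).const_mul K
  have hae := (ae_restrict_mem (μ := volume) (measurableSet_Ioi (a := (0:ℝ)))).mono hbound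
  refine ⟨?_, ?_⟩
  · have key := integral_Ioi_mul_deriv_eq_deriv_mul (a := (0:ℝ)) (u := g) (u' := g') (v := v)
      (v' := fun t : ℝ => Complex.exp (-(t * ζ))) (a' := 0) (b' := 0)
      (fun t ht => hasDerivAt_pow_mul_log_add (hα.differentiable (by simp))
        (hβ.differentiable (by simp)) n ht) (fun t _ => hv t) ?_ ?_ ?_ ?_
    · rw [sub_zero, zero_sub] at key
      rw [integral_congr_ae (ae_of_all _ fun t => mul_comm _ _), key]
      exact congrArg _ (integral_congr_ae (ae_of_all _ fun t => mul_comm _ _))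
    · refine Integrable.mono' (integrableOn_indicator_rpow A (p := -δ) (by linarith)) ?_ ?_
      · exact (hgm.mul (by fun_prop)).aestronglyMeasurable
      · filter_upwards [ae_restrict_mem measurableSet_Ioi] with t ht
        have ht : 0 < t := ht
        have h := hAb t ht
        have he : ‖Complex.exp (-(t * ζ))‖ ≤ 1 := by
          rw [Complex.norm_exp]
          have : 0 ≤ t * ζ.re := by positivity
          simpa using this
        have hn : ‖(t : ℂ) ^ n‖ ≤ 1 ∨ 1 < t := by
          rcases le_or_gt t 1 with h1 | h1
          · left
            rw [norm_pow, Complex.norm_real, Real.norm_eq_abs, abs_of_pos ht]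
            exact pow_le_one₀ ht.le h1
          · exact Or.inr h1
        have hgle : ‖g t‖ ≤ ‖α t * (Real.log t : ℂ) + β t‖ := by
          rcases hn with hn | hn
          · simp only [hg]
            rw [norm_mul]
            exact mul_le_of_le_one_left (norm_nonneg _) hn
          · simp [hg, hα0 t hn, hβ0 t hn]
        rw [Pi.mul_apply, norm_mul]
        exact (mul_le_of_le_one_right (norm_nonneg _) he).trans (hgle.trans h)
    · refine Integrable.mono' hint (hgm'.mul hvc.measurable).aestronglyMeasurable ?_
      filter_upwards [hae] with t ht
      rwa [Pi.mul_apply, mul_comm]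
    · have hlim : Tendsto (fun t : ℝ => K * A * t ^ (n + θ - δ)) (nhdsWithin 0 (Set.Ioi 0))
          (nhds 0) := by
        have : Tendsto (fun t : ℝ => K * A * t ^ (n + θ - δ)) (nhds 0)
            (nhds (K * A * 0 ^ (n + θ - δ))) :=
          ((Real.continuousAt_rpow_const 0 (n + θ - δ) (Or.inr (by linarith))).tendsto).const_mul _
        rw [Real.zero_rpow (by linarith), mul_zero] at this
        exact this.mono_left nhdsWithin_le_nhds
      refine squeeze_zero_norm' ?_ hlim
      filter_upwards [Ioc_mem_nhdsGT (zero_lt_one' ℝ)] with t ht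
      have h := hAb t ht.1
      rw [Set.indicator_of_mem ht] at h
      have ht0 : 0 < t := ht.1
      have e : t ^ (n + θ - δ) = t ^ n * t ^ θ * t ^ (-δ) := by
        rw [← Real.rpow_natCast t n, ← Real.rpow_add ht0, ← Real.rpow_add ht0]
        ring_nf
      rw [Pi.mul_apply, norm_mul, hg, norm_mul, norm_pow, Complex.norm_real, Real.norm_eq_abs,
        abs_of_pos ht0, e]
      calc t ^ n * _ * ‖v t‖ ≤ t ^ n * (A * t ^ (-δ)) * (K * t ^ θ) := by
            gcongr
            exact hvb t ht0 ht.2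
        _ = _ := by ring
    · refine tendsto_const_nhds.congr' ?_
      filter_upwards [Ioi_mem_atTop (1:ℝ)] with t ht
      simp [hg, hα0 t ht, hβ0 t ht]
  · refine (norm_integral_le_of_norm_le hint hae).trans_eq ?_
    rw [integral_const_mul]

lemma hasDerivAt_exp_neg_mul_const (ζ : ℂ) (t : ℝ) :
    HasDerivAt (fun t : ℝ => Complex.exp (-(t * ζ))) (-ζ * Complex.exp (-(t * ζ))) t := by
  have h : HasDerivAt (fun t : ℝ => -((t : ℂ) * ζ)) (-ζ) t := by
    simpa using ((Complex.ofRealCLM.hasDerivAt (x := t)).mul_const ζ).fun_neg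
  simpa [mul_comm] using h.cexp

/-- Laplace transforms of `t ^ n (α log t + β)` decay like `|ζ| ^ (-(n + 1) + δ)` in the
right half-plane. -/
theorem exists_norm_laplace_log_le {δ : ℝ} (hδ : 0 < δ) (hδ1 : δ < 1) (n : ℕ) :
    ∀ {α β : ℝ → ℂ}, ContDiff ℝ (⊤ : ℕ∞) α → ContDiff ℝ (⊤ : ℕ∞) β →
    (∀ t, 1 < t → α t = 0) → (∀ t, 1 < t → β t = 0) →
    ∃ C : ℝ, 0 ≤ C ∧ ∀ ζ : ℂ, 0 ≤ ζ.re → ζ ≠ 0 →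
      ‖∫ t in Set.Ioi (0:ℝ), Complex.exp (-(t * ζ)) *
        ((t : ℂ) ^ n * (α t * (Real.log t : ℂ) + β t))‖ ≤ C * ‖ζ‖ ^ (-(n + 1 : ℝ) + δ) := by
  induction n with
  | zero =>
    intro α β hα hβ hα0 hβ0
    obtain ⟨C, hC, h⟩ := laplace_log_integral_by_parts hα hβ hα0 hβ0 0 (θ := δ) (by simpa)
    refine ⟨2 * C, by positivity, fun ζ hζ hζ0 => ?_⟩
    have hpos : 0 < ‖ζ‖ := norm_pos_iff.2 hζ0
    have hv : ∀ t : ℝ, HasDerivAt (fun t : ℝ => (1 - Complex.exp (-(t * ζ))) / ζ)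
        (Complex.exp (-(t * ζ))) t := fun t => by
      have := ((hasDerivAt_exp_neg_mul_const ζ t).const_sub 1).div_const ζ
      refine this.congr_deriv ?_
      field_simp
    have hvb : ∀ t : ℝ, 0 < t → t ≤ 1 →
        ‖(1 - Complex.exp (-(t * ζ))) / ζ‖ ≤ 2 * ‖ζ‖ ^ δ / ‖ζ‖ * t ^ δ := fun t ht _ => by
      have h3 := norm_one_sub_exp_neg_le (z := t * ζ) (by simp; positivity) hδ.le hδ1.le
      rw [norm_mul, Complex.norm_real, Real.norm_eq_abs, abs_of_pos ht,
        Real.mul_rpow ht.le hpos.le] at h3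
      rw [norm_div, div_mul_eq_mul_div]
      gcongr
      linarith
    obtain ⟨h1, h2⟩ := h ζ _ _ hζ (by positivity) hv hvb
    rw [h1, norm_neg]
    refine h2.trans_eq ?_
    rw [Nat.cast_zero, zero_add, Real.rpow_add hpos, Real.rpow_neg_one]
    ring
  | succ n ih =>
    intro α β hα hβ hα0 hβ0
    have hdα : ContDiff ℝ (⊤ : ℕ∞) (deriv α) := hα.deriv' 
    have hdβ : ContDiff ℝ (⊤ : ℕ∞) (deriv β) := hβ.deriv' 
    have hid : ContDiff ℝ (⊤ : ℕ∞) (fun t : ℝ => (t : ℂ)) := Complex.ofRealCLM.contDiff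
    obtain ⟨C, hC, h⟩ := laplace_log_integral_by_parts hα hβ hα0 hβ0 (n + 1) (θ := 0)
      (by positivity)
    obtain ⟨B, hB, hBb⟩ := ih (α := fun t => t * deriv α t + (n + 1 : ℕ) * α t)
      (β := fun t => t * deriv β t + (n + 1 : ℕ) * β t + α t)
      ((hid.mul hdα).add (contDiff_const.mul hα))
      (((hid.mul hdβ).add (contDiff_const.mul hβ)).add hα)
      (fun t ht => by simp [hα0 t ht, deriv_eq_zero_of_eqOn_Ioi hα0 ht])
      (fun t ht => by simp [hα0 t ht, hβ0 t ht, deriv_eq_zero_of_eqOn_Ioi hβ0 ht])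
    refine ⟨B, hB, fun ζ hζ hζ0 => ?_⟩
    have hpos : 0 < ‖ζ‖ := norm_pos_iff.2 hζ0
    have hv : ∀ t : ℝ, HasDerivAt (fun t : ℝ => -ζ⁻¹ * Complex.exp (-(t * ζ)))
        (Complex.exp (-(t * ζ))) t := fun t => by
      have := (hasDerivAt_exp_neg_mul_const ζ t).const_mul (-ζ⁻¹)
      refine this.congr_deriv ?_
      field_simp
    have hvb : ∀ t : ℝ, 0 < t → t ≤ 1 →
        ‖-ζ⁻¹ * Complex.exp (-(t * ζ))‖ ≤ ‖ζ‖⁻¹ * t ^ (0:ℝ) := fun t ht _ => by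
      rw [norm_mul, norm_neg, norm_inv, Complex.norm_exp, Real.rpow_zero]
      gcongr
      rw [Real.exp_le_one_iff]
      have : 0 ≤ t * ζ.re := by positivity
      simpa using this
    obtain ⟨h1, -⟩ := h ζ _ _ hζ (by positivity) hv hvb
    have e : (∫ t in Set.Ioi (0:ℝ), (-ζ⁻¹ * Complex.exp (-(t * ζ))) * ((t : ℂ) ^ (n + 1) *
        ((t * deriv α t + (n + 1 : ℕ) * α t) * (Real.log t : ℂ) +
          (t * deriv β t + (n + 1 : ℕ) * β t + α t)) / t)) =
        -ζ⁻¹ * ∫ t in Set.Ioi (0:ℝ), Complex.exp (-(t * ζ)) * ((t : ℂ) ^ n *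
        ((t * deriv α t + (n + 1 : ℕ) * α t) * (Real.log t : ℂ) +
          (t * deriv β t + (n + 1 : ℕ) * β t + α t))) := by
      rw [← integral_const_mul]
      refine setIntegral_congr_fun measurableSet_Ioi fun t ht => ?_
      have htc : (t : ℂ) ≠ 0 := by exact_mod_cast (ne_of_gt ht)
      simp only [pow_succ]
      field_simp
    rw [h1, e, norm_neg, norm_mul, norm_neg, norm_inv]
    refine (mul_le_mul_of_nonneg_left (hBb ζ hζ hζ0) (by positivity)).trans_eq ?_
    rw [show (-(((n + 1 : ℕ) : ℝ) + 1) + δ) = (-((n : ℝ) + 1) + δ) + -1 by push_cast; ring,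
      Real.rpow_add hpos _ (-1), Real.rpow_neg_one]
    ring

lemma tendsto_sinh_atTop : Tendsto Real.sinh atTop atTop :=
  tendsto_atTop_mono' _ (by
    filter_upwards [Ici_mem_atTop (0:ℝ)] with x hx using Real.self_le_sinh_iff.2 hx) tendsto_id

lemma norm_exp_I_mul_cosh_add (z x y : ℝ) :
    ‖Complex.exp (Complex.I * z * Complex.cosh (x + y * Complex.I))‖ =
      Real.exp (-(z * Real.sinh x * Real.sin y)) := by
  rw [Complex.norm_exp, Complex.cosh_add, Complex.cosh_mul_I, Complex.sinh_mul_I,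
    ← Complex.ofReal_cosh, ← Complex.ofReal_sinh, ← Complex.ofReal_cos, ← Complex.ofReal_sin]
  congr 1
  simp [-Complex.ofReal_cosh, -Complex.ofReal_sinh, -Complex.ofReal_cos, -Complex.ofReal_sin]
  ring

lemma tendsto_integral_exp_I_mul_cosh_add {z : ℝ} (hz : 0 < z) :
    Tendsto (fun T : ℝ => ∫ y in (0:ℝ)..Real.pi,
      Complex.exp (Complex.I * z * Complex.cosh (T + y * Complex.I))) atTop (nhds 0) := by
  have h := intervalIntegral.tendsto_integral_filter_of_dominated_convergence
    (a := (0:ℝ)) (b := Real.pi) (μ := volume) (l := atTop)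
    (F := fun (T : ℝ) (y : ℝ) => Complex.exp (Complex.I * z * Complex.cosh (T + y * Complex.I)))
    (f := fun _ => (0:ℂ)) (fun _ => 1)
    (Eventually.of_forall fun T => (by fun_prop : Continuous _).aestronglyMeasurable)
    ?_ (by simp) ?_
  · simpa using h
  · filter_upwards [Ici_mem_atTop (0:ℝ)] with T hT
    refine ae_of_all _ fun y hy => ?_
    rw [Set.uIoc_of_le Real.pi_pos.le] at hy
    rw [norm_exp_I_mul_cosh_add, Real.exp_le_one_iff]
    have h1 := Real.sin_nonneg_of_nonneg_of_le_pi hy.1.le hy.2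
    have h2 := Real.sinh_nonneg_iff.2 hT
    have : 0 ≤ z * Real.sinh T * Real.sin y := by positivity
    linarith
  · have hne : ∀ᵐ y : ℝ, y ≠ Real.pi := by simp [ae_iff, measure_singleton]
    filter_upwards [hne] with y hpi hy
    rw [Set.uIoc_of_le Real.pi_pos.le] at hy
    have hs : 0 < Real.sin y := Real.sin_pos_of_pos_of_lt_pi hy.1 (lt_of_le_of_ne hy.2 hpi)
    rw [tendsto_zero_iff_norm_tendsto_zero]
    simp only [norm_exp_I_mul_cosh_add]
    refine Real.tendsto_exp_neg_atTop_nhds_zero.comp ?_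
    exact (tendsto_sinh_atTop.const_mul_atTop hz).atTop_mul_const hs

lemma integral_cos_mul_cos_eq (z : ℝ) :
    ∫ y in (0:ℝ)..Real.pi, Real.cos (z * Real.cos y) = Real.pi * J0 z := by
  have hper : Function.Periodic (fun y => Real.cos (z * Real.sin y)) Real.pi := fun y => by
    simp [Real.sin_add_pi]
  have h1 := hper.intervalIntegral_add_eq 0 (Real.pi / 2)
  have h2 := intervalIntegral.integral_comp_add_right (a := 0) (b := Real.pi)
    (fun y => Real.cos (z * Real.sin y)) (Real.pi / 2)
  simp only [Real.sin_add_pi_div_two, zero_add] at h1 h2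
  rw [J0, h2, h1, add_comm Real.pi]
  field_simp

/-- The representation of `J₀` as an improper integral, obtained by moving the contour. -/
lemma tendsto_integral_sin_mul_cosh {z : ℝ} (hz : 0 < z) :
    Tendsto (fun T : ℝ => ∫ t in (0:ℝ)..T, Real.sin (z * Real.cosh t)) atTop
      (nhds (Real.pi / 2 * J0 z)) := by
  set f : ℂ → ℂ := fun t => Complex.exp (Complex.I * z * Complex.cosh t) with hf
  have hfd : Differentiable ℂ f := by fun_prop
  have hfc : Continuous f := hfd.continuous
  have key : ∀ T : ℝ, ((∫ t in (0:ℝ)..T, Real.sin (z * Real.cosh t) : ℝ) : ℂ) =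
      1 / 2 * ((∫ y in (0:ℝ)..Real.pi, f (y * Complex.I)) -
        ∫ y in (0:ℝ)..Real.pi, f (T + y * Complex.I)) := by
    intro T
    have h := Complex.integral_boundary_rect_eq_zero_of_differentiableOn f 0
      (T + Real.pi * Complex.I) hfd.differentiableOn
    simp only [Complex.zero_re, Complex.zero_im, Complex.add_re, Complex.add_im,
      Complex.ofReal_re, Complex.ofReal_im, Complex.mul_re, Complex.mul_im, Complex.I_re,
      Complex.I_im, mul_zero, mul_one, zero_mul, sub_zero, add_zero, zero_add,
      Complex.ofReal_zero, smul_eq_mul] at h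
    rw [← intervalIntegral.integral_sub ((by fun_prop : Continuous _).intervalIntegrable _ _)
      ((by fun_prop : Continuous _).intervalIntegrable _ _)] at h
    have e : ∀ x : ℝ, f x - f (x + Real.pi * Complex.I) =
        2 * Complex.I * ((Real.sin (z * Real.cosh x) : ℝ) : ℂ) := by
      intro x
      simp only [hf, Complex.cosh_add_pi_mul_I]
      push_cast
      rw [Complex.sin]
      ring_nf
      simp only [Complex.I_sq]
      ring_nf
    simp only [e] at h
    rw [intervalIntegral.integral_const_mul, intervalIntegral.integral_ofReal] at h
    have h' : Complex.I * (2 * ((∫ t in (0:ℝ)..T, Real.sin (z * Real.cosh t) : ℝ) : ℂ) +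
      (∫ y in (0:ℝ)..Real.pi, f (T + y * Complex.I)) -
        ∫ y in (0:ℝ)..Real.pi, f (y * Complex.I)) = 0 := by linear_combination h
    have h'' := (mul_eq_zero.1 h').resolve_left Complex.I_ne_zero
    linear_combination h'' / 2
  have hlim := ((tendsto_const_nhds (x := ∫ y in (0:ℝ)..Real.pi, f (y * Complex.I))).sub
    (tendsto_integral_exp_I_mul_cosh_add hz)).const_mul (1 / 2 : ℂ)
  have hre := (Complex.continuous_re.tendsto _).comp hlim
  have hI : (∫ y in (0:ℝ)..Real.pi, f (y * Complex.I)).re = Real.pi * J0 z := by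
    rw [← integral_cos_mul_cos_eq]
    have := Complex.reCLM.intervalIntegral_comp_comm (a := 0) (b := Real.pi) (μ := volume)
      (f := fun y : ℝ => f (y * Complex.I))
      ((by fun_prop : Continuous _).intervalIntegrable _ _)
    simp only [Complex.reCLM_apply] at this
    rw [← this]
    refine intervalIntegral.integral_congr fun y _ => ?_
    simp only [hf, Complex.cosh_mul_I, ← Complex.ofReal_cos]
    rw [show Complex.I * z * (Real.cos y : ℂ) = ((z * Real.cos y : ℝ) : ℂ) * Complex.I by
      push_cast; ring, Complex.exp_ofReal_mul_I_re]
  have e0 : (1 / 2 * ((∫ y in (0:ℝ)..Real.pi, f (y * Complex.I)) - 0)).re =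
      Real.pi / 2 * J0 z := by
    rw [sub_zero, show (1 / 2 : ℂ) = ((1 / 2 : ℝ) : ℂ) by push_cast; rfl, Complex.re_ofReal_mul, hI]
    ring
  rw [e0] at hre
  refine hre.congr fun T => ?_
  have := congrArg Complex.re (key T)
  rw [Complex.ofReal_re] at this
  exact this.symm

/-- The integrand of the Hankel function in the variable `q` with `cosh t = 1 + q ^ 2`. -/
noncomputable def hankelIntegrand (z : ℝ) (q : ℂ) : ℂ :=
  2 * Complex.exp (-(Complex.I * z * (1 + q ^ 2))) * (2 + q ^ 2) ^ ((-(1 / 2) : ℝ) : ℂ)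

lemma two_add_sq_mem_slitPlane {q : ℂ} (h : q.re ≠ 0 ∨ q.im ^ 2 < 2) :
    2 + q ^ 2 ∈ Complex.slitPlane := by
  rw [Complex.mem_slitPlane_iff]
  simp only [pow_two, Complex.add_re, Complex.add_im, Complex.mul_re, Complex.mul_im]
  norm_num
  by_cases hx : q.re = 0
  · left
    have := h.resolve_left (fun h => h hx)
    nlinarith
  · by_cases hy : q.im = 0
    · left; rw [hy]; nlinarith [sq_nonneg q.re]
    · right
      intro h0
      have : q.re * q.im = 0 := by linarith
      rcases mul_eq_zero.1 this with h | h <;> contradiction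

lemma differentiableAt_hankelIntegrand (z : ℝ) {q : ℂ} (h : 2 + q ^ 2 ∈ Complex.slitPlane) :
    DifferentiableAt ℂ (hankelIntegrand z) q := by
  unfold hankelIntegrand
  refine DifferentiableAt.mul (by fun_prop) ?_
  exact DifferentiableAt.cpow_const (by fun_prop) h

lemma mem_ball_iff_normSq {R : ℝ} {q : ℂ} :
    q ∈ Metric.ball (R : ℂ) (Real.sqrt (R ^ 2 + 2)) ↔
      q.re ^ 2 + q.im ^ 2 < 2 * R * q.re + 2 := by
  rw [Metric.mem_ball, Complex.dist_eq, Complex.norm_def, Real.sqrt_lt_sqrt_iff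
    (Complex.normSq_nonneg _), Complex.normSq_apply]
  simp only [Complex.sub_re, Complex.sub_im, Complex.ofReal_re, Complex.ofReal_im, sub_zero]
  constructor <;> intro h <;> nlinarith

lemma exists_primitive_hankelIntegrand (z R : ℝ) :
    ∃ F : ℂ → ℂ, ∀ q : ℂ, q.re ^ 2 + q.im ^ 2 < 2 * R * q.re + 2 →
      HasDerivAt F (hankelIntegrand z q) q ∧ ContinuousAt (hankelIntegrand z) q := by
  have hd : ∀ q ∈ Metric.ball (R : ℂ) (Real.sqrt (R ^ 2 + 2)),
      DifferentiableAt ℂ (hankelIntegrand z) q := by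
    intro q hq
    rw [mem_ball_iff_normSq] at hq
    refine differentiableAt_hankelIntegrand z (two_add_sq_mem_slitPlane ?_)
    by_cases h : q.re = 0
    · right; rw [h] at hq; linarith
    · exact Or.inl h
  obtain ⟨F, hF⟩ := DifferentiableOn.isExactOn_ball
    (fun q hq => (hd q hq).differentiableWithinAt)
  exact ⟨F, fun q hq => ⟨hF q (mem_ball_iff_normSq.2 hq),
    (hd q (mem_ball_iff_normSq.2 hq)).continuousAt⟩⟩

lemma integral_comp_of_hasDerivAt {F f : ℂ → ℂ} {γ γ' : ℝ → ℂ} {a b : ℝ}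
    (hF : ∀ t ∈ Set.uIcc a b, HasDerivAt F (f (γ t)) (γ t) ∧ ContinuousAt f (γ t))
    (hγ : ∀ t, HasDerivAt γ (γ' t) t) (hγ' : Continuous γ') :
    ∫ t in a..b, f (γ t) * γ' t = F (γ b) - F (γ a) := by
  refine intervalIntegral.integral_eq_sub_of_hasDerivAt
    (f := fun t => F (γ t)) (fun t ht => ?_) ?_
  · exact HasDerivAt.comp_of_eq t (hF t ht).1 (hγ t) rfl
  · refine ContinuousOn.intervalIntegrable fun t ht => ?_
    refine ContinuousAt.continuousWithinAt (ContinuousAt.mul ?_ hγ'.continuousAt)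
    exact ContinuousAt.comp (f := γ) (hF t ht).2 (hγ t).continuousAt

lemma hankelIntegrand_sinh (z t : ℝ) :
    hankelIntegrand z ((Real.sqrt 2 * Real.sinh (t / 2) : ℝ) : ℂ) *
      ((Real.sqrt 2 * (Real.cosh (t / 2) * (1 / 2)) : ℝ) : ℂ) =
      Complex.exp (-(Complex.I * z * Real.cosh t)) := by
  have h2 : Real.sqrt 2 ^ 2 = 2 := Real.sq_sqrt (by norm_num)
  have hc : Real.cosh t = 1 + (Real.sqrt 2 * Real.sinh (t / 2)) ^ 2 := by
    have h3 := Real.cosh_two_mul (t / 2)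
    have h4 := Real.cosh_sq (t / 2)
    rw [show 2 * (t / 2) = t by ring] at h3
    rw [mul_pow, h2]; linarith
  have hs : 2 + (Real.sqrt 2 * Real.sinh (t / 2)) ^ 2 =
      (Real.sqrt 2 * Real.cosh (t / 2)) ^ 2 := by
    rw [mul_pow, mul_pow, h2, Real.cosh_sq]; ring
  have hpos : 0 < Real.sqrt 2 * Real.cosh (t / 2) := by
    have := Real.cosh_pos (t / 2); positivity
  unfold hankelIntegrand
  have e : (2 + ((Real.sqrt 2 * Real.sinh (t / 2) : ℝ) : ℂ) ^ 2) ^ ((-(1 / 2) : ℝ) : ℂ) =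
      ((Real.sqrt 2 * Real.cosh (t / 2))⁻¹ : ℝ) := by
    rw [show (2 + ((Real.sqrt 2 * Real.sinh (t / 2) : ℝ) : ℂ) ^ 2) =
      ((2 + (Real.sqrt 2 * Real.sinh (t / 2)) ^ 2 : ℝ) : ℂ) by push_cast; rfl, hs,
      ← Complex.ofReal_cpow (by positivity), Real.rpow_neg (by positivity), ← Real.sqrt_eq_rpow,
      Real.sqrt_sq hpos.le]
  rw [e, hc]
  have hne : ((Real.sqrt 2 * Real.cosh (t / 2) : ℝ) : ℂ) ≠ 0 := by exact_mod_cast hpos.ne'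
  rw [show ((Real.sqrt 2 * (Real.cosh (t / 2) * (1 / 2)) : ℝ) : ℂ) =
    ((Real.sqrt 2 * Real.cosh (t / 2) : ℝ) : ℂ) / 2 by push_cast; ring, Complex.ofReal_inv]
  field_simp
  push_cast
  ring_nf

lemma norm_hankelIntegrand_mul_arc_le {z R θ : ℝ} (hR : 0 < R) (h0 : 0 ≤ θ)
    (h1 : θ ≤ Real.pi / 4) :
    ‖hankelIntegrand z (R * Complex.exp (-(θ * Complex.I))) *
      (R * (-Complex.I * Complex.exp (-(θ * Complex.I))))‖ ≤
      2 * Real.exp (-(z * R ^ 2 * Real.sin (2 * θ))) := by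
  have hq : (R * Complex.exp (-(θ * Complex.I))) ^ 2 =
      ((R ^ 2 * Real.cos (2 * θ) : ℝ) : ℂ) - ((R ^ 2 * Real.sin (2 * θ) : ℝ) : ℂ) * Complex.I := by
    rw [mul_pow, ← Complex.exp_nat_mul,
      show ((2 : ℕ) : ℂ) * -(θ * Complex.I) = (-(2 * θ : ℝ) : ℝ) * Complex.I by push_cast; ring,
      Complex.exp_mul_I, ← Complex.ofReal_cos, ← Complex.ofReal_sin, Real.cos_neg, Real.sin_neg]
    push_cast
    ring
  have hcos : 0 ≤ Real.cos (2 * θ) :=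
    Real.cos_nonneg_of_neg_pi_div_two_le_of_le (by linarith [Real.pi_pos]) (by linarith)
  have hbig : R ^ 2 ≤ ‖2 + (R * Complex.exp (-(θ * Complex.I))) ^ 2‖ := by
    rw [hq, Complex.norm_def]
    refine Real.le_sqrt_of_sq_le ?_
    rw [Complex.normSq_apply]
    simp only [Complex.add_re, Complex.add_im, Complex.sub_re, Complex.sub_im, Complex.mul_re,
      Complex.mul_im, Complex.ofReal_re, Complex.ofReal_im, Complex.I_re, Complex.I_im,
      Complex.re_ofNat, Complex.im_ofNat]
    have := Real.sin_sq_add_cos_sq (2 * θ)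
    have h3 : 0 ≤ R ^ 2 * Real.cos (2 * θ) := by positivity
    nlinarith [sq_nonneg R]
  have hE : ‖Complex.exp (-(θ * Complex.I))‖ = 1 := by
    rw [Complex.norm_exp]; simp
  have hpow : ‖(2 + (R * Complex.exp (-(θ * Complex.I))) ^ 2 : ℂ) ^ ((-(1 / 2) : ℝ) : ℂ)‖ ≤
      R⁻¹ := by
    rw [Complex.norm_cpow_real]
    refine (Real.rpow_le_rpow_of_nonpos (by positivity) hbig (by norm_num)).trans_eq ?_
    rw [Real.rpow_neg (by positivity), ← Real.sqrt_eq_rpow, Real.sqrt_sq hR.le]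
  have hexp : ‖Complex.exp (-(Complex.I * z * (1 + (R * Complex.exp (-(θ * Complex.I))) ^ 2)))‖ =
      Real.exp (-(z * R ^ 2 * Real.sin (2 * θ))) := by
    rw [hq, Complex.norm_exp]
    congr 1
    generalize R ^ 2 * Real.cos (2 * θ) = u
    rw [mul_assoc z]
    generalize R ^ 2 * Real.sin (2 * θ) = v
    simp
  unfold hankelIntegrand
  rw [norm_mul, norm_mul, norm_mul, norm_mul, norm_mul, hexp, hE, norm_neg, Complex.norm_I,
    Complex.norm_real, Real.norm_eq_abs, abs_of_pos hR]
  calc _ ≤ ‖(2:ℂ)‖ * Real.exp (-(z * R ^ 2 * Real.sin (2 * θ))) * R⁻¹ * (R * (1 * 1)) := by gcongr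
    _ = _ := by
      rw [show ‖(2:ℂ)‖ = 2 by simp]; field_simp

/-- The direction of steepest descent `ω = exp (-iπ/4)`. -/
noncomputable def descentDir : ℂ := Complex.exp (-((Real.pi / 4 : ℝ) * Complex.I))

lemma descentDir_sq : descentDir ^ 2 = -Complex.I := by
  rw [descentDir, ← Complex.exp_nat_mul,
    show ((2 : ℕ) : ℂ) * -((Real.pi / 4 : ℝ) * Complex.I) = -(Real.pi / 2 * Complex.I) by
      push_cast; ring, Complex.exp_neg, Complex.exp_pi_div_two_mul_I, Complex.inv_I]

lemma norm_descentDir : ‖descentDir‖ = 1 := by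
  rw [descentDir, Complex.norm_exp]; simp

lemma half_le_descentDir_re : 1 / 2 ≤ descentDir.re := by
  rw [descentDir, show -((Real.pi / 4 : ℝ) * Complex.I) = ((-(Real.pi / 4) : ℝ) : ℂ) * Complex.I by
    push_cast; ring, Complex.exp_ofReal_mul_I_re, Real.cos_neg, Real.cos_pi_div_four]
  have : 1 ≤ Real.sqrt 2 := Real.one_le_sqrt.2 (by norm_num)
  linarith

lemma sq_lt_of_norm_le {R : ℝ} {q : ℂ} (h : ‖q‖ ≤ R) (h' : ‖q‖ ≤ 2 * q.re) :
    q.re ^ 2 + q.im ^ 2 < 2 * R * q.re + 2 := by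
  have h1 : q.re ^ 2 + q.im ^ 2 = ‖q‖ ^ 2 := by
    rw [Complex.sq_norm, Complex.normSq_apply]; ring
  have := norm_nonneg q
  rw [h1]; nlinarith

lemma integral_exp_cosh_eq (z T : ℝ) (hT : 0 ≤ T) :
    ∫ t in (0:ℝ)..T, Complex.exp (-(Complex.I * z * Real.cosh t)) =
      (∫ p in (0:ℝ)..Real.sqrt 2 * Real.sinh (T / 2),
        hankelIntegrand z (descentDir * p) * descentDir) -
      ∫ θ in (0:ℝ)..Real.pi / 4,
        hankelIntegrand z ((Real.sqrt 2 * Real.sinh (T / 2) : ℝ) *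
          Complex.exp (-(θ * Complex.I))) *
        ((Real.sqrt 2 * Real.sinh (T / 2) : ℝ) *
          (-Complex.I * Complex.exp (-(θ * Complex.I)))) := by
  have hR0 : 0 ≤ Real.sqrt 2 * Real.sinh (T / 2) := by
    have := Real.sinh_nonneg_iff.2 (by linarith : 0 ≤ T / 2); positivity
  set R := Real.sqrt 2 * Real.sinh (T / 2) with hR
  obtain ⟨F, hF⟩ := exists_primitive_hankelIntegrand z R
  have p1 := integral_comp_of_hasDerivAt (F := F) (f := hankelIntegrand z)
    (γ := fun t => ((Real.sqrt 2 * Real.sinh (t / 2) : ℝ) : ℂ))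
    (γ' := fun t => ((Real.sqrt 2 * (Real.cosh (t / 2) * (1 / 2)) : ℝ) : ℂ)) (a := 0) (b := T)
    (fun t ht => by
      rw [Set.uIcc_of_le hT] at ht
      refine hF _ (sq_lt_of_norm_le ?_ ?_)
      all_goals
        have h0 : 0 ≤ Real.sqrt 2 * Real.sinh (t / 2) := by
          have := Real.sinh_nonneg_iff.2 (by linarith [ht.1] : 0 ≤ t / 2); positivity
        rw [Complex.norm_real, Real.norm_eq_abs, abs_of_nonneg h0]
      · rw [hR]; gcongr; exact Real.sinh_le_sinh.2 (by linarith [ht.2])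
      · rw [Complex.ofReal_re]; linarith)
    (fun t => by
      refine HasDerivAt.ofReal_comp ?_
      refine HasDerivAt.const_mul _ ?_
      exact HasDerivAt.sinh ((hasDerivAt_id t).div_const 2))
    (by fun_prop)
  have p2 := integral_comp_of_hasDerivAt (F := F) (f := hankelIntegrand z)
    (γ := fun p => descentDir * (p : ℂ)) (γ' := fun _ => descentDir) (a := 0) (b := R)
    (fun p hp => by
      rw [Set.uIcc_of_le hR0] at hp
      have h0 := half_le_descentDir_re
      refine hF _ (sq_lt_of_norm_le ?_ ?_)
      all_goals rw [norm_mul, norm_descentDir, Complex.norm_real, Real.norm_eq_abs,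
        abs_of_nonneg hp.1, one_mul]
      · exact hp.2
      · rw [Complex.re_mul_ofReal]; nlinarith [hp.1])
    (fun p => by
      simpa using (Complex.ofRealCLM.hasDerivAt (x := p)).const_mul descentDir)
    (by fun_prop)
  have p3 := integral_comp_of_hasDerivAt (F := F) (f := hankelIntegrand z)
    (γ := fun θ => (R : ℂ) * Complex.exp (-(θ * Complex.I)))
    (γ' := fun θ => (R : ℂ) * (-Complex.I * Complex.exp (-(θ * Complex.I))))
    (a := 0) (b := Real.pi / 4)
    (fun θ hθ => by
      rw [Set.uIcc_of_le (by positivity)] at hθ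
      have hn : ‖(R : ℂ) * Complex.exp (-(θ * Complex.I))‖ = R := by
        rw [norm_mul, Complex.norm_real, Real.norm_eq_abs, abs_of_nonneg hR0, Complex.norm_exp]
        simp
      refine hF _ (sq_lt_of_norm_le hn.le ?_)
      rw [hn, Complex.re_ofReal_mul,
        show -(θ * Complex.I) = ((-θ : ℝ) : ℂ) * Complex.I by push_cast; ring,
        Complex.exp_ofReal_mul_I_re, Real.cos_neg]
      have h1 : Real.cos (Real.pi / 4) ≤ Real.cos θ :=
        Real.cos_le_cos_of_nonneg_of_le_pi hθ.1 (by linarith [Real.pi_pos]) hθ.2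
      rw [Real.cos_pi_div_four] at h1
      have : 1 ≤ Real.sqrt 2 := Real.one_le_sqrt.2 (by norm_num)
      nlinarith)
    (fun θ => by
      have h : HasDerivAt (fun θ : ℝ => -((θ : ℂ) * Complex.I)) (-(1 * Complex.I)) θ :=
        ((Complex.ofRealCLM.hasDerivAt (x := θ)).mul_const Complex.I).fun_neg
      refine (h.cexp.const_mul (R : ℂ)).congr_deriv ?_
      ring)
    (by fun_prop)
  simp only [hankelIntegrand_sinh] at p1
  rw [p1, p2, p3]
  have e : F (descentDir * (R : ℂ)) =
      F (R * Complex.exp (-(((Real.pi / 4 : ℝ) : ℂ) * Complex.I))) := by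
    rw [mul_comm, descentDir]
  rw [e]
  simp [hR]

/-- The amplitude of the Laplace representation of the Hankel function. -/
noncomputable def hankelAmp (p : ℝ) : ℂ :=
  2 * Complex.I / Real.pi * (2 * descentDir * (2 - Complex.I * p ^ 2) ^ ((-(1 / 2) : ℝ) : ℂ))

lemma continuous_hankelAmp : Continuous hankelAmp := by
  unfold hankelAmp
  refine continuous_const.mul (continuous_const.mul ?_)
  refine Continuous.cpow (by fun_prop) continuous_const fun p => ?_
  rw [Complex.mem_slitPlane_iff, ← Complex.ofReal_pow]
  generalize p ^ 2 = u
  left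
  simp

lemma norm_sq_add_I_le (p : ℝ) : ‖(p:ℂ) ^ 2 + Complex.I‖ ≤ ‖2 - Complex.I * (p:ℂ) ^ 2‖ := by
  rw [Complex.norm_def, Complex.norm_def]
  refine Real.sqrt_le_sqrt ?_
  rw [Complex.normSq_apply, Complex.normSq_apply, ← Complex.ofReal_pow]
  generalize p ^ 2 = u
  simp
  nlinarith

lemma one_le_norm_sq_add_I (p : ℝ) : 1 ≤ ‖(p:ℂ) ^ 2 + Complex.I‖ := by
  have := Complex.abs_im_le_norm ((p:ℂ) ^ 2 + Complex.I)
  simpa [← Complex.ofReal_pow] using this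

lemma norm_hankelAmp (p : ℝ) :
    ‖hankelAmp p‖ = 4 / Real.pi * ‖2 - Complex.I * (p:ℂ) ^ 2‖ ^ (-(1 / 2) : ℝ) := by
  rw [hankelAmp, norm_mul, norm_mul, norm_mul, norm_descentDir, Complex.norm_cpow_real, norm_div,
    norm_mul, Complex.norm_I, Complex.norm_real, Real.norm_eq_abs, abs_of_pos Real.pi_pos]
  simp
  ring

lemma norm_hankelAmp_le (p : ℝ) : ‖hankelAmp p‖ ≤ 2 := by
  rw [norm_hankelAmp]
  have h : ‖2 - Complex.I * (p:ℂ) ^ 2‖ ^ (-(1 / 2) : ℝ) ≤ 1 :=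
    Real.rpow_le_one_of_one_le_of_nonpos
      ((one_le_norm_sq_add_I p).trans (norm_sq_add_I_le p)) (by norm_num)
  have h2 : 4 / Real.pi ≤ 2 := by
    rw [div_le_iff₀ Real.pi_pos]; linarith [Real.pi_gt_three]
  calc _ ≤ 2 * (1:ℝ) := by gcongr
    _ = 2 := by norm_num

lemma hankelIntegrand_descentDir (z p : ℝ) :
    2 * Complex.I / Real.pi * (hankelIntegrand z (descentDir * p) * descentDir) =
      hankelAmp p * Complex.exp (-(z * ((p:ℂ) ^ 2 + Complex.I))) := by
  rw [hankelIntegrand, hankelAmp, mul_pow, descentDir_sq,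
    show -(Complex.I * z * (1 + -Complex.I * (p:ℂ) ^ 2)) = -(z * ((p:ℂ) ^ 2 + Complex.I)) by
      ring_nf; simp only [Complex.I_sq]; ring,
    show 2 + -Complex.I * (p:ℂ) ^ 2 = 2 - Complex.I * (p:ℂ) ^ 2 by ring]
  ring

lemma norm_exp_neg_mul_sq_add_I (z p : ℝ) :
    ‖Complex.exp (-(z * ((p:ℂ) ^ 2 + Complex.I)))‖ = Real.exp (-z * p ^ 2) := by
  rw [Complex.norm_exp, ← Complex.ofReal_pow]
  generalize p ^ 2 = u
  simp

lemma integrable_hankelAmp_mul_exp {z : ℝ} (hz : 0 < z) :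
    Integrable fun p : ℝ => hankelAmp p * Complex.exp (-(z * ((p:ℂ) ^ 2 + Complex.I))) := by
  refine Integrable.mono' ((integrable_exp_neg_mul_sq hz).const_mul 2) ?_ ?_
  · exact (continuous_hankelAmp.mul (by fun_prop)).aestronglyMeasurable
  · refine ae_of_all _ fun p => ?_
    rw [norm_mul, norm_exp_neg_mul_sq_add_I]
    gcongr
    exact norm_hankelAmp_le p

lemma tendsto_integral_arc {z : ℝ} (hz : 0 < z) :
    Tendsto (fun R : ℝ => ∫ θ in (0:ℝ)..Real.pi / 4,
        hankelIntegrand z (R * Complex.exp (-(θ * Complex.I))) *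
        (R * (-Complex.I * Complex.exp (-(θ * Complex.I))))) atTop (nhds 0) := by
  have hp : (0:ℝ) ≤ Real.pi / 4 := by positivity
  have h := intervalIntegral.tendsto_integral_filter_of_dominated_convergence
    (a := (0:ℝ)) (b := Real.pi / 4) (μ := volume) (l := atTop)
    (F := fun (R : ℝ) (θ : ℝ) => hankelIntegrand z (R * Complex.exp (-(θ * Complex.I))) *
        (R * (-Complex.I * Complex.exp (-(θ * Complex.I)))))
    (f := fun _ => (0:ℂ)) (fun _ => 2) ?_ ?_ (by simp) ?_
  · simpa using h
  · refine Eventually.of_forall fun R => Measurable.aestronglyMeasurable ?_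
    unfold hankelIntegrand
    fun_prop
  · filter_upwards [Ioi_mem_atTop (0:ℝ)] with R hR
    refine ae_of_all _ fun θ hθ => ?_
    rw [Set.uIoc_of_le hp] at hθ
    refine (norm_hankelIntegrand_mul_arc_le hR hθ.1.le hθ.2).trans ?_
    have h1 := Real.sin_nonneg_of_nonneg_of_le_pi (x := 2 * θ) (by linarith [hθ.1])
      (by linarith [hθ.2, Real.pi_pos])
    have : Real.exp (-(z * R ^ 2 * Real.sin (2 * θ))) ≤ 1 := by
      rw [Real.exp_le_one_iff]
      have : 0 ≤ z * R ^ 2 * Real.sin (2 * θ) := by positivity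
      linarith
    linarith
  · refine ae_of_all _ fun θ hθ => ?_
    rw [Set.uIoc_of_le hp] at hθ
    have hs : 0 < Real.sin (2 * θ) := Real.sin_pos_of_pos_of_lt_pi (by linarith [hθ.1])
      (by linarith [hθ.2, Real.pi_pos])
    have hlim : Tendsto (fun R : ℝ => 2 * Real.exp (-(z * R ^ 2 * Real.sin (2 * θ)))) atTop
        (nhds 0) := by
      have h1 : Tendsto (fun R : ℝ => z * R ^ 2 * Real.sin (2 * θ)) atTop atTop :=
        ((tendsto_pow_atTop two_ne_zero).const_mul_atTop hz).atTop_mul_const hs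
      simpa using (Real.tendsto_exp_neg_atTop_nhds_zero.comp h1).const_mul 2
    refine squeeze_zero_norm' ?_ hlim
    filter_upwards [Ioi_mem_atTop (0:ℝ)] with R hR
    exact norm_hankelIntegrand_mul_arc_le hR hθ.1.le hθ.2

lemma tendsto_integral_exp_cosh {z : ℝ} (hz : 0 < z) :
    Tendsto (fun T : ℝ => 2 * Complex.I / Real.pi *
      ∫ t in (0:ℝ)..T, Complex.exp (-(Complex.I * z * Real.cosh t))) atTop
      (nhds (∫ p in Set.Ioi (0:ℝ),
        hankelAmp p * Complex.exp (-(z * ((p:ℂ) ^ 2 + Complex.I))))) := by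
  have hR : Tendsto (fun T : ℝ => Real.sqrt 2 * Real.sinh (T / 2)) atTop atTop :=
    (tendsto_sinh_atTop.comp (tendsto_id.atTop_div_const (by norm_num : (0:ℝ) < 2))).const_mul_atTop
      (by positivity)
  have h1 := (intervalIntegral_tendsto_integral_Ioi 0
    (integrable_hankelAmp_mul_exp hz).integrableOn tendsto_id).comp hR
  have h2 := ((tendsto_integral_arc hz).comp hR).const_mul (2 * Complex.I / Real.pi)
  have h3 := h1.sub h2
  rw [mul_zero, sub_zero] at h3
  refine h3.congr' ?_
  filter_upwards [Ici_mem_atTop (0:ℝ)] with T hT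
  rw [integral_exp_cosh_eq z T hT, mul_sub]
  congr 1
  rw [← intervalIntegral.integral_const_mul]
  exact intervalIntegral.integral_congr fun p _ => (hankelIntegrand_descentDir z p).symm

/-- The Laplace representation of the Hankel function. -/
lemma hankel_eq_integral {z y : ℝ} (hz : 0 < z)
    (hy : Tendsto (fun T : ℝ => ∫ t in (0:ℝ)..T, Real.cos (z * Real.cosh t)) atTop
        (nhds (-(Real.pi / 2) * y))) :
    (J0 z : ℂ) - Complex.I * y = ∫ p in Set.Ioi (0:ℝ),
      hankelAmp p * Complex.exp (-(z * ((p:ℂ) ^ 2 + Complex.I))) := by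
  refine tendsto_nhds_unique ?_ (tendsto_integral_exp_cosh hz)
  have hc := (Complex.continuous_ofReal.tendsto _).comp hy
  have hs := (Complex.continuous_ofReal.tendsto _).comp (tendsto_integral_sin_mul_cosh hz)
  have h := (hc.sub (hs.const_mul Complex.I)).const_mul (2 * Complex.I / Real.pi)
  have hpi : (Real.pi : ℂ) ≠ 0 := by exact_mod_cast Real.pi_ne_zero
  have e : 2 * Complex.I / Real.pi * (((-(Real.pi / 2) * y : ℝ) : ℂ) -
      Complex.I * ((Real.pi / 2 * J0 z : ℝ) : ℂ)) = (J0 z : ℂ) - Complex.I * y := by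
    push_cast
    field_simp
    ring_nf
    simp only [Complex.I_sq]
    ring
  rw [e] at h
  refine h.congr fun T => ?_
  simp only [Function.comp_apply]
  congr 1
  rw [← intervalIntegral.integral_ofReal, ← intervalIntegral.integral_ofReal,
    ← intervalIntegral.integral_const_mul, ← intervalIntegral.integral_sub
      ((by fun_prop : Continuous _).intervalIntegrable _ _)
      ((by fun_prop : Continuous _).intervalIntegrable _ _)]
  refine intervalIntegral.integral_congr fun t _ => ?_
  rw [show -(Complex.I * z * Real.cosh t) = ((-(z * Real.cosh t) : ℝ) : ℂ) * Complex.I by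
    push_cast; ring, Complex.exp_mul_I, ← Complex.ofReal_cos, ← Complex.ofReal_sin, Real.cos_neg,
    Real.sin_neg]
  push_cast
  ring

/-- The amplitude of the Laplace representation of the derivative of the Hankel function. -/
noncomputable def hankelDerivAmp (p : ℝ) : ℂ := -((p:ℂ) ^ 2 + Complex.I) * hankelAmp p

lemma continuous_hankelDerivAmp : Continuous hankelDerivAmp := by
  unfold hankelDerivAmp
  exact Continuous.mul (by fun_prop) continuous_hankelAmp

lemma norm_sq_add_I_le_one_add_sq (p : ℝ) : ‖(p:ℂ) ^ 2 + Complex.I‖ ≤ 1 + p ^ 2 := by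
  refine (norm_add_le _ _).trans ?_
  rw [Complex.norm_I, norm_pow, Complex.norm_real, Real.norm_eq_abs, sq_abs, add_comm]

lemma norm_hankelDerivAmp_le (p : ℝ) : ‖hankelDerivAmp p‖ ≤ 2 * Real.sqrt (1 + p ^ 2) := by
  have h1 := one_le_norm_sq_add_I p
  have h2 := norm_sq_add_I_le p
  have h3 : 4 / Real.pi ≤ 2 := by
    rw [div_le_iff₀ Real.pi_pos]; linarith [Real.pi_gt_three]
  have h0 : 0 < ‖(p:ℂ) ^ 2 + Complex.I‖ := by linarith
  rw [hankelDerivAmp, norm_mul, norm_neg, norm_hankelAmp]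
  calc _ ≤ ‖(p:ℂ) ^ 2 + Complex.I‖ * (2 * ‖(p:ℂ) ^ 2 + Complex.I‖ ^ (-(1 / 2) : ℝ)) := by
        gcongr ?_ * (?_ * ?_)
        exact Real.rpow_le_rpow_of_nonpos h0 h2 (by norm_num)
    _ = 2 * Real.sqrt ‖(p:ℂ) ^ 2 + Complex.I‖ := by
        rw [Real.sqrt_eq_rpow, mul_left_comm, ← Real.rpow_one_add' h0.le (by norm_num)]
        norm_num
    _ ≤ _ := by
        gcongr
        exact norm_sq_add_I_le_one_add_sq p

lemma hasDerivAt_integral_hankelAmp {z : ℝ} (hz : 0 < z) :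
    HasDerivAt (fun z : ℝ => ∫ p in Set.Ioi (0:ℝ),
        hankelAmp p * Complex.exp (-(z * ((p:ℂ) ^ 2 + Complex.I))))
      (∫ p in Set.Ioi (0:ℝ),
        hankelDerivAmp p * Complex.exp (-(z * ((p:ℂ) ^ 2 + Complex.I)))) z := by
  have hb : 0 < z / 2 := by positivity
  have hint : Integrable (fun p : ℝ => 2 * (Real.exp (-(z / 2) * p ^ 2) +
      p ^ (2:ℝ) * Real.exp (-(z / 2) * p ^ 2))) :=
    ((integrable_exp_neg_mul_sq hb).add
      (integrable_rpow_mul_exp_neg_mul_sq hb (by norm_num : (-1:ℝ) < 2))).const_mul 2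
  refine (hasDerivAt_integral_of_dominated_loc_of_deriv_le
    (F := fun (z p : ℝ) => hankelAmp p * Complex.exp (-(z * ((p:ℂ) ^ 2 + Complex.I))))
    (F' := fun (z p : ℝ) => hankelDerivAmp p * Complex.exp (-(z * ((p:ℂ) ^ 2 + Complex.I))))
    (s := Set.Ioi (z / 2)) (Ioi_mem_nhds (by linarith)) ?_ ?_ ?_ ?_ hint.integrableOn ?_).2
  · exact Eventually.of_forall fun y =>
      (continuous_hankelAmp.mul (by fun_prop)).aestronglyMeasurable
  · exact (integrable_hankelAmp_mul_exp hz).integrableOn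
  · exact (continuous_hankelDerivAmp.mul (by fun_prop)).aestronglyMeasurable
  · refine ae_of_all _ fun p y hy => ?_
    have hy' : z / 2 < y := hy
    rw [norm_mul, norm_exp_neg_mul_sq_add_I, Real.rpow_two]
    have h1 : Real.sqrt (1 + p ^ 2) ≤ 1 + p ^ 2 := by
      rw [Real.sqrt_le_left (by positivity)]; nlinarith [sq_nonneg p]
    have h2 : Real.exp (-y * p ^ 2) ≤ Real.exp (-(z / 2) * p ^ 2) := by
      gcongr
    calc _ ≤ 2 * (1 + p ^ 2) * Real.exp (-(z / 2) * p ^ 2) := by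
          gcongr
          exact (norm_hankelDerivAmp_le p).trans (by gcongr)
      _ = _ := by ring
  · refine ae_of_all _ fun p y _ => ?_
    have h : HasDerivAt (fun y : ℝ => -((y:ℂ) * ((p:ℂ) ^ 2 + Complex.I)))
        (-(1 * ((p:ℂ) ^ 2 + Complex.I))) y :=
      ((Complex.ofRealCLM.hasDerivAt (x := y)).mul_const _).fun_neg
    refine (h.cexp.const_mul (hankelAmp p)).congr_deriv ?_
    rw [hankelDerivAmp]
    ring

lemma hasDerivAt_J0 (z : ℝ) :
    HasDerivAt J0 ((1 / Real.pi) * ∫ θ in (0:ℝ)..Real.pi,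
      -Real.sin (z * Real.sin θ) * Real.sin θ) z := by
  have h := (intervalIntegral.hasDerivAt_integral_of_dominated_loc_of_deriv_le (μ := volume)
    (F := fun (z θ : ℝ) => Real.cos (z * Real.sin θ))
    (F' := fun (z θ : ℝ) => -Real.sin (z * Real.sin θ) * Real.sin θ)
    (a := 0) (b := Real.pi) (bound := fun _ => 1) (x₀ := z)
    (s := Set.univ) univ_mem
    (Eventually.of_forall fun y => (by fun_prop : Continuous _).aestronglyMeasurable)
    ((by fun_prop : Continuous _).intervalIntegrable _ _)
    ((by fun_prop : Continuous _).aestronglyMeasurable)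
    (ae_of_all _ fun θ _ y _ => by
      rw [norm_mul, norm_neg, Real.norm_eq_abs, Real.norm_eq_abs]
      exact mul_le_one₀ (Real.abs_sin_le_one _) (abs_nonneg _) (Real.abs_sin_le_one _))
    (by simp)
    (ae_of_all _ fun θ _ y _ => by
      simpa using ((hasDerivAt_id y).mul_const (Real.sin θ)).cos)).2
  exact h.const_mul (1 / Real.pi)

lemma deriv_J0_eq_integral_exp (z : ℝ) :
    ((deriv J0 z : ℝ) : ℂ) = ∫ θ in Set.Ioc (-Real.pi) Real.pi,
      Complex.I * Real.sin θ / (2 * Real.pi) *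
        Complex.exp (-(z * -(Complex.I * Real.sin θ))) := by
  set g : ℝ → ℂ := fun θ => Complex.I * Real.sin θ / (2 * Real.pi) *
        Complex.exp (-(z * -(Complex.I * Real.sin θ))) with hg
  have hgc : Continuous g := by fun_prop
  have hpi := Real.pi_pos
  rw [(hasDerivAt_J0 z).deriv, ← intervalIntegral.integral_of_le (by linarith),
    ← intervalIntegral.integral_add_adjacent_intervals (b := 0)
      (hgc.intervalIntegrable _ _) (hgc.intervalIntegrable _ _)]
  have h1 := intervalIntegral.integral_comp_neg (a := 0) (b := Real.pi) g
  rw [neg_zero] at h1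
  rw [← h1, ← intervalIntegral.integral_add
    ((by fun_prop : Continuous _).intervalIntegrable _ _) (hgc.intervalIntegrable _ _)]
  push_cast
  rw [← intervalIntegral.integral_ofReal, ← intervalIntegral.integral_const_mul]
  refine intervalIntegral.integral_congr fun θ _ => ?_
  have hpi' : (Real.pi : ℂ) ≠ 0 := by exact_mod_cast hpi.ne'
  simp only [hg, Real.sin_neg]
  push_cast
  have hs : Complex.sin (z * Complex.sin θ) = (Complex.exp (-(z * Complex.sin θ) * Complex.I) -
    Complex.exp (z * Complex.sin θ * Complex.I)) * Complex.I / 2 := rfl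
  rw [hs]
  field_simp
  ring_nf

/-- A Fubini bound for a product of two Laplace-type integrals, integrated against a weight. -/
lemma norm_integral_mul_integral_mul_integral_le {μ ν : Measure ℝ} [SFinite μ] [SFinite ν]
    {g : ℝ → ℝ} {f : ℝ → ℂ} (hf : Measurable f)
    {k φ m σ : ℝ → ℂ} (hk : Measurable k) (hφ : Measurable φ) (hm : Measurable m)
    (hσ : Measurable σ) {A B : ℝ → ℝ} (hA : Integrable A μ) (hB : Integrable B ν)
    (hg : IntegrableOn g (Set.Ioi 0))
    (hbound : ∀ t : ℝ, 0 < t → ∀ p y : ℝ, ‖f t * (k p * Complex.exp (-(t * φ p)) *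
      (m y * Complex.exp (-(t * σ y))))‖ ≤ g t * (A p * B y))
    {b c : ℝ → ℝ} (hb : Integrable b μ) (hc : Integrable c ν)
    (hbc : ∀ p y : ℝ, ‖k p‖ * ‖m y‖ *
      ‖∫ t in Set.Ioi (0:ℝ), Complex.exp (-(t * (φ p + σ y))) * f t‖ ≤ b p * c y) :
    IntegrableOn (fun t : ℝ => f t * ((∫ p, k p * Complex.exp (-(t * φ p)) ∂μ) *
      ∫ y, m y * Complex.exp (-(t * σ y)) ∂ν)) (Set.Ioi 0) ∧
    ‖∫ t in Set.Ioi (0:ℝ), f t * ((∫ p, k p * Complex.exp (-(t * φ p)) ∂μ) *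
      ∫ y, m y * Complex.exp (-(t * σ y)) ∂ν)‖ ≤ (∫ p, b p ∂μ) * ∫ y, c y ∂ν := by
  have e : ∀ t : ℝ, f t * ((∫ p, k p * Complex.exp (-(t * φ p)) ∂μ) *
      ∫ y, m y * Complex.exp (-(t * σ y)) ∂ν) =
      ∫ x : ℝ × ℝ, f t * (k x.1 * Complex.exp (-(t * φ x.1)) *
        (m x.2 * Complex.exp (-(t * σ x.2)))) ∂(μ.prod ν) := by
    intro t
    rw [integral_const_mul, integral_prod_mul (fun p => k p * Complex.exp (-(t * φ p)))
      (fun y => m y * Complex.exp (-(t * σ y)))]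
  simp only [e]
  have hint : Integrable (Function.uncurry fun (t : ℝ) (x : ℝ × ℝ) =>
      f t * (k x.1 * Complex.exp (-(t * φ x.1)) * (m x.2 * Complex.exp (-(t * σ x.2)))))
      ((volume.restrict (Set.Ioi 0)).prod (μ.prod ν)) := by
    refine Integrable.mono' (hg.mul_prod (hA.mul_prod hB)) ?_ ?_
    · refine Measurable.aestronglyMeasurable ?_
      unfold Function.uncurry
      fun_prop
    · have h : ∀ᵐ z ∂((volume.restrict (Set.Ioi (0:ℝ))).prod (μ.prod ν)), 0 < z.1 := by
        have := Measure.quasiMeasurePreserving_fst (μ := volume.restrict (Set.Ioi (0:ℝ)))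
          (ν := μ.prod ν)
        exact this.ae (ae_restrict_mem (μ := volume) measurableSet_Ioi)
      filter_upwards [h] with z hz
      exact hbound z.1 hz z.2.1 z.2.2
  refine ⟨hint.integral_prod_left, ?_⟩
  rw [integral_integral_swap hint, ← integral_prod_mul]
  refine norm_integral_le_of_norm_le (hb.mul_prod hc) (ae_of_all _ fun x => ?_)
  refine le_trans (le_of_eq ?_) (hbc x.1 x.2)
  rw [← norm_mul, ← norm_mul, ← integral_const_mul]
  congr 2
  ext t
  rw [mul_add, neg_add, Complex.exp_add]
  ring

lemma exp_neg_le_rpow {u : ℝ} (hu : 0 < u) : Real.exp (-u) ≤ u ^ (-(3 / 2) : ℝ) := by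
  rw [Real.rpow_def_of_pos hu, Real.exp_le_exp]
  have h1 := Real.log_le_sub_one_of_pos (by positivity : 0 < 2 * u / 3)
  have h2 := Real.log_le_sub_one_of_pos (by norm_num : (0:ℝ) < 3 / 2)
  have h3 : Real.log u = Real.log (2 * u / 3) + Real.log (3 / 2) := by
    rw [← Real.log_mul (by positivity) (by norm_num)]; congr 1; ring
  linarith

lemma sqrt_mul_exp_neg_le {t r p : ℝ} (ht : 0 < t) (ht1 : t ≤ 1) (hr : 0 < r) :
    Real.sqrt (1 + p ^ 2) * Real.exp (-(t * r) * p ^ 2) ≤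
      t ^ (-(3 / 2) : ℝ) * (3 * (min 1 r) ^ (-(3 / 2) : ℝ) * (1 + p ^ 2)⁻¹) := by
  set ρ := min 1 r with hρ
  have hρ0 : 0 < ρ := lt_min one_pos hr
  have hp : 0 < 1 + p ^ 2 := by positivity
  have h1 : Real.exp (-(t * r) * p ^ 2) ≤ 3 * Real.exp (-(t * (ρ * (1 + p ^ 2)))) := by
    have e1 : Real.exp 1 ≤ 3 := by linarith [Real.exp_one_lt_d9]
    calc _ ≤ Real.exp (1 + -(t * (ρ * (1 + p ^ 2)))) := by
          gcongr
          have ha : t * ρ ≤ 1 := mul_le_one₀ ht1 hρ0.le (min_le_left _ _)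
          have hb : t * ρ * p ^ 2 ≤ t * r * p ^ 2 := by
            gcongr; exact min_le_right _ _
          nlinarith
      _ = Real.exp 1 * Real.exp (-(t * (ρ * (1 + p ^ 2)))) := Real.exp_add _ _
      _ ≤ _ := by gcongr
  have h2 := exp_neg_le_rpow (u := t * (ρ * (1 + p ^ 2))) (by positivity)
  rw [Real.mul_rpow ht.le (by positivity), Real.mul_rpow hρ0.le hp.le] at h2
  have h3 : Real.sqrt (1 + p ^ 2) * (1 + p ^ 2) ^ (-(3 / 2) : ℝ) = (1 + p ^ 2)⁻¹ := by
    rw [Real.sqrt_eq_rpow, ← Real.rpow_add hp, ← Real.rpow_neg_one]; norm_num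
  calc _ ≤ Real.sqrt (1 + p ^ 2) * (3 * (t ^ (-(3 / 2) : ℝ) *
        (ρ ^ (-(3 / 2) : ℝ) * (1 + p ^ 2) ^ (-(3 / 2) : ℝ)))) := by
        gcongr; exact h1.trans (by gcongr)
    _ = t ^ (-(3 / 2) : ℝ) * (3 * ρ ^ (-(3 / 2) : ℝ) *
        (Real.sqrt (1 + p ^ 2) * (1 + p ^ 2) ^ (-(3 / 2) : ℝ))) := by ring
    _ = _ := by rw [h3]

lemma exists_norm_cube_mul_log_add_le {α β : ℝ → ℂ} (hα : Continuous α) (hβ : Continuous β)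
    (hα0 : ∀ t, 1 < t → α t = 0) (hβ0 : ∀ t, 1 < t → β t = 0) :
    ∃ C : ℝ, 0 ≤ C ∧ ∀ t : ℝ, 0 < t → ‖(t : ℂ) ^ 3 * (α t * (Real.log t : ℂ) + β t)‖ ≤
      (Set.Ioc 0 1).indicator (fun t : ℝ => C * t ^ (5 / 2 : ℝ)) t := by
  obtain ⟨C, hC, h⟩ := exists_norm_mul_log_add_le hα hβ hα0 hβ0 (δ := 1 / 2) (by norm_num)
  refine ⟨C, hC, fun t ht => ?_⟩
  have h1 := h t ht
  rw [norm_mul, norm_pow, Complex.norm_real, Real.norm_eq_abs, abs_of_pos ht]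
  by_cases hm : t ∈ Set.Ioc (0:ℝ) 1
  · rw [Set.indicator_of_mem hm] at h1 ⊢
    calc _ ≤ t ^ 3 * (C * t ^ (-(1 / 2) : ℝ)) := by gcongr
      _ = C * (t ^ (3:ℝ) * t ^ (-(1 / 2) : ℝ)) := by rw [← Real.rpow_natCast]; push_cast; ring
      _ = _ := by rw [← Real.rpow_add ht]; norm_num
  · rw [Set.indicator_of_notMem hm] at h1 ⊢
    rw [le_antisymm h1 (norm_nonneg _), mul_zero]

lemma exists_norm_laplace_log_le_rpow {δ : ℝ} (hδ : 0 < δ) (hδ1 : δ < 1) {α β : ℝ → ℂ}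
    (hα : ContDiff ℝ (⊤ : ℕ∞) α) (hβ : ContDiff ℝ (⊤ : ℕ∞) β)
    (hα0 : ∀ t, 1 < t → α t = 0) (hβ0 : ∀ t, 1 < t → β t = 0) :
    ∃ C : ℝ, 0 ≤ C ∧ ∀ ζ : ℂ, 0 ≤ ζ.re → ∀ S : ℝ, 0 < S → S ≤ 18 * (1 + ‖ζ‖) →
      ‖∫ t in Set.Ioi (0:ℝ), Complex.exp (-(t * ζ)) *
        ((t : ℂ) ^ 3 * (α t * (Real.log t : ℂ) + β t))‖ ≤ C * S ^ (-4 + δ) := by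
  obtain ⟨C₁, hC₁, h₁⟩ := exists_norm_laplace_log_le hδ hδ1 3 hα hβ hα0 hβ0
  obtain ⟨C₂, hC₂, h₂⟩ := exists_norm_cube_mul_log_add_le hα.continuous hβ.continuous hα0 hβ0
  have hint := integrableOn_indicator_rpow C₂ (by norm_num : (-1:ℝ) < 5 / 2)
  set M := ∫ t in Set.Ioi (0:ℝ), (Set.Ioc 0 1).indicator (fun t : ℝ => C₂ * t ^ (5 / 2 : ℝ)) t
    with hM
  have hM0 : 0 ≤ M := by
    refine setIntegral_nonneg measurableSet_Ioi fun t ht => ?_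
    exact (norm_nonneg _).trans (h₂ t ht)
  have htriv : ∀ ζ : ℂ, 0 ≤ ζ.re → ‖∫ t in Set.Ioi (0:ℝ), Complex.exp (-(t * ζ)) *
        ((t : ℂ) ^ 3 * (α t * (Real.log t : ℂ) + β t))‖ ≤ M := by
    intro ζ hζ
    refine norm_integral_le_of_norm_le hint ?_
    filter_upwards [ae_restrict_mem (μ := volume) measurableSet_Ioi] with t ht
    have ht' : 0 < t := ht
    rw [norm_mul]
    refine (mul_le_of_le_one_left (norm_nonneg _) ?_).trans (h₂ t ht)
    rw [Complex.norm_exp, Real.exp_le_one_iff, Complex.neg_re, Complex.re_ofReal_mul]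
    have : 0 ≤ t * ζ.re := by positivity
    linarith
  refine ⟨(C₁ + M) * 36 ^ (4 - δ), by positivity, fun ζ hζ S hS hS' => ?_⟩
  have h36 : (36:ℝ) ^ (4 - δ) * S ^ (-4 + δ) = (S / 36) ^ (-4 + δ) := by
    rw [Real.div_rpow hS.le (by norm_num), show (4 - δ) = -(-4 + δ) by ring,
      Real.rpow_neg (by norm_num)]
    field_simp
  rw [mul_assoc, h36]
  have hpos : 0 < (S / 36) ^ (-4 + δ) := by positivity
  rcases le_total 1 ‖ζ‖ with h | h
  · have hζ0 : ζ ≠ 0 := by rintro rfl; norm_num at h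
    refine (h₁ ζ hζ hζ0).trans ?_
    have e : (-(((3:ℕ):ℝ) + 1) + δ) = -4 + δ := by push_cast; ring
    rw [e]
    have : ‖ζ‖ ^ (-4 + δ) ≤ (S / 36) ^ (-4 + δ) :=
      Real.rpow_le_rpow_of_nonpos (by positivity) (by linarith) (by linarith)
    calc _ ≤ C₁ * (S / 36) ^ (-4 + δ) := by gcongr
      _ ≤ _ := by gcongr; linarith
  · refine (htriv ζ hζ).trans ?_
    have : 1 ≤ (S / 36) ^ (-4 + δ) :=
      Real.one_le_rpow_of_pos_of_le_one_of_nonpos (by positivity) (by linarith) (by linarith)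
    calc M = M * 1 := (mul_one _).symm
      _ ≤ _ := by gcongr; linarith

lemma integrableOn_one_add_mul_sq_rpow {δ r : ℝ} (hδ : 0 < δ) (hr : 0 < r) :
    IntegrableOn (fun p : ℝ => (1 + r * p ^ 2) ^ (-((1 + δ) / 2))) (Set.Ioi 0) ∧
    ∫ p in Set.Ioi (0:ℝ), (1 + r * p ^ 2) ^ (-((1 + δ) / 2)) =
      (Real.sqrt r)⁻¹ * ∫ p in Set.Ioi (0:ℝ), (1 + p ^ 2) ^ (-((1 + δ) / 2)) := by
  have hs : 0 < Real.sqrt r := Real.sqrt_pos.2 hr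
  set g : ℝ → ℝ := fun x => (1 + x ^ 2) ^ (-((1 + δ) / 2)) with hg
  have e : (fun p : ℝ => (1 + r * p ^ 2) ^ (-((1 + δ) / 2))) = fun p => g (Real.sqrt r * p) := by
    ext p
    simp only [hg, mul_pow, Real.sq_sqrt hr.le]
  have h1 : Integrable g := by
    have := integrable_rpow_neg_one_add_norm_sq (E := ℝ) (μ := volume) (r := 1 + δ)
      (by simp; linarith)
    simpa only [neg_div, Real.norm_eq_abs, sq_abs] using this
  rw [e]
  constructor
  · rw [integrableOn_Ioi_comp_mul_left_iff _ _ hs]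
    exact h1.integrableOn
  · rw [integral_comp_mul_left_Ioi _ _ hs]
    simp

lemma norm_mul_exp_neg_mul_sq_add_le {k : ℂ} {r p η t : ℝ} (hk : ‖k‖ ≤ 2 * Real.sqrt (1 + p ^ 2))
    (hr : 0 < r) (ht : 0 < t) (ht1 : t ≤ 1) :
    ‖k * Complex.exp (-(t * (r * ((p:ℂ) ^ 2 + η * Complex.I))))‖ ≤
      t ^ (-(3 / 2) : ℝ) * (2 * (3 * (min 1 r) ^ (-(3 / 2) : ℝ) * (1 + p ^ 2)⁻¹)) := by
  have e : ‖Complex.exp (-(t * (r * ((p:ℂ) ^ 2 + η * Complex.I))))‖ =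
      Real.exp (-(t * r) * p ^ 2) := by
    rw [Complex.norm_exp, ← Complex.ofReal_pow, Complex.neg_re, Complex.re_ofReal_mul,
      Complex.re_ofReal_mul]
    generalize p ^ 2 = u
    simp
    ring
  rw [norm_mul, e]
  have h := sqrt_mul_exp_neg_le (p := p) ht ht1 hr
  calc _ ≤ 2 * Real.sqrt (1 + p ^ 2) * Real.exp (-(t * r) * p ^ 2) := by gcongr
    _ = 2 * (Real.sqrt (1 + p ^ 2) * Real.exp (-(t * r) * p ^ 2)) := by ring
    _ ≤ 2 * (t ^ (-(3 / 2) : ℝ) * (3 * (min 1 r) ^ (-(3 / 2) : ℝ) * (1 + p ^ 2)⁻¹)) := by gcongr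
    _ = _ := by ring

lemma norm_mul_mul_le_indicator {f x y : ℂ} {C X Y t : ℝ} (ht : 0 < t)
    (hf : ‖f‖ ≤ (Set.Ioc 0 1).indicator (fun t : ℝ => C * t ^ (5 / 2 : ℝ)) t)
    (hx : t ≤ 1 → ‖x‖ ≤ t ^ (-(3 / 2) : ℝ) * X) (hy : t ≤ 1 → ‖y‖ ≤ t ^ (-(3 / 2) : ℝ) * Y) :
    ‖f * (x * y)‖ ≤ (Set.Ioc 0 1).indicator (fun t : ℝ => C * t ^ (-(1 / 2) : ℝ)) t * (X * Y) := by
  rw [norm_mul, norm_mul]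
  by_cases hm : t ∈ Set.Ioc (0:ℝ) 1
  · rw [Set.indicator_of_mem hm] at hf ⊢
    have hx' := hx hm.2
    have hy' := hy hm.2
    have hX : 0 ≤ t ^ (-(3 / 2) : ℝ) * X := (norm_nonneg _).trans hx'
    have hC : 0 ≤ C * t ^ (5 / 2 : ℝ) := (norm_nonneg _).trans hf
    calc _ ≤ C * t ^ (5 / 2 : ℝ) * (t ^ (-(3 / 2) : ℝ) * X * (t ^ (-(3 / 2) : ℝ) * Y)) := by gcongr
      _ = C * (t ^ (5 / 2 : ℝ) * t ^ (-(3 / 2) : ℝ) * t ^ (-(3 / 2) : ℝ)) * (X * Y) := by ring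
      _ = _ := by rw [← Real.rpow_add ht, ← Real.rpow_add ht]; norm_num
  · rw [Set.indicator_of_notMem hm] at hf ⊢
    rw [le_antisymm hf (norm_nonneg _)]
    simp

lemma add_abs_le_two_mul_norm (z : ℂ) (h : 0 ≤ z.re) : z.re + |z.im| ≤ 2 * ‖z‖ := by
  have h1 := Complex.abs_re_le_norm z
  have h2 := Complex.abs_im_le_norm z
  rw [abs_of_nonneg h] at h1
  linarith

/-- Bounds for the contribution of one exponential of `J₀'`, in terms of pointwise bounds on the
Laplace side. -/
lemma norm_integral_exp_mul_exp_le {δ C₀ C₁ : ℝ} {f : ℝ → ℂ} (hf : Measurable f)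
    (hf0 : ∀ t : ℝ, 0 < t → ‖f t‖ ≤
      (Set.Ioc 0 1).indicator (fun t : ℝ => C₀ * t ^ (5 / 2 : ℝ)) t)
    (hC₁ : 0 ≤ C₁)
    (hG : ∀ ζ : ℂ, 0 ≤ ζ.re → ∀ S : ℝ, 0 < S → S ≤ 18 * (1 + ‖ζ‖) →
      ‖∫ t in Set.Ioi (0:ℝ), Complex.exp (-(t * ζ)) * f t‖ ≤ C₁ * S ^ (-4 + δ))
    {m : ℝ → ℂ} (hm : Measurable m) (hm2 : ∀ q, ‖m q‖ ≤ 2 * Real.sqrt (1 + q ^ 2))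
    {η : ℝ} (hη : η = 1 ∨ η = -1) {r s : ℝ} (hr : 0 < r) (hs : 0 < s)
    {S : ℝ → ℝ → ℝ} (hS : ∀ p q, 0 < S p q)
    (hS2 : ∀ p q, S p q ≤ 9 * (1 + |r - s| + r * p ^ 2 + s * q ^ 2))
    {b c : ℝ → ℝ} (hb : IntegrableOn b (Set.Ioi 0)) (hc : IntegrableOn c (Set.Ioi 0))
    (hbc : ∀ p q : ℝ, Real.sqrt (1 + p ^ 2) * Real.sqrt (1 + q ^ 2) * S p q ^ (-4 + δ) ≤
      b p * c q) :
    IntegrableOn (fun t : ℝ => f t *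
      ((∫ p in Set.Ioi (0:ℝ), hankelDerivAmp p *
        Complex.exp (-(t * (r * ((p:ℂ) ^ 2 + (1:ℝ) * Complex.I))))) *
      ∫ q in Set.Ioi (0:ℝ), m q * Complex.exp (-(t * (s * ((q:ℂ) ^ 2 + η * Complex.I))))))
      (Set.Ioi 0) ∧
    ‖∫ t in Set.Ioi (0:ℝ), f t *
      ((∫ p in Set.Ioi (0:ℝ), hankelDerivAmp p *
        Complex.exp (-(t * (r * ((p:ℂ) ^ 2 + (1:ℝ) * Complex.I))))) *
      ∫ q in Set.Ioi (0:ℝ), m q * Complex.exp (-(t * (s * ((q:ℂ) ^ 2 + η * Complex.I)))))‖ ≤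
      4 * C₁ * ((∫ p in Set.Ioi (0:ℝ), b p) * ∫ q in Set.Ioi (0:ℝ), c q) := by
  have hI : IntegrableOn (fun p : ℝ => (1 + p ^ 2)⁻¹) (Set.Ioi 0) :=
    integrable_inv_one_add_sq.integrableOn
  have key := norm_integral_mul_integral_mul_integral_le
    (μ := volume.restrict (Set.Ioi 0)) (ν := volume.restrict (Set.Ioi 0)) hf
    (k := hankelDerivAmp) (φ := fun p => r * ((p:ℂ) ^ 2 + (1:ℝ) * Complex.I)) (m := m)
    (σ := fun q => s * ((q:ℂ) ^ 2 + η * Complex.I))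
    continuous_hankelDerivAmp.measurable (by fun_prop) hm (by fun_prop)
    ((hI.const_mul (3 * (min 1 r) ^ (-(3 / 2) : ℝ))).const_mul 2)
    ((hI.const_mul (3 * (min 1 s) ^ (-(3 / 2) : ℝ))).const_mul 2)
    (integrableOn_indicator_rpow C₀ (by norm_num : (-1:ℝ) < -(1 / 2)))
    (fun t ht p q => norm_mul_mul_le_indicator ht (hf0 t ht)
      (fun h => norm_mul_exp_neg_mul_sq_add_le (norm_hankelDerivAmp_le p) hr ht h)
      (fun h => norm_mul_exp_neg_mul_sq_add_le (hm2 q) hs ht h))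
    (hb.const_mul (4 * C₁)) hc ?_
  · refine ⟨key.1, key.2.trans_eq ?_⟩
    rw [integral_const_mul, mul_assoc]
  · intro p q
    set ζ : ℂ := r * ((p:ℂ) ^ 2 + (1:ℝ) * Complex.I) + s * ((q:ℂ) ^ 2 + η * Complex.I) with hζ
    have hre : ζ.re = r * p ^ 2 + s * q ^ 2 := by
      rw [hζ, ← Complex.ofReal_pow, ← Complex.ofReal_pow]
      generalize p ^ 2 = u
      generalize q ^ 2 = v
      simp
    have him : |r - s| ≤ |ζ.im| := by
      have : ζ.im = r + s * η := by
        rw [hζ, ← Complex.ofReal_pow, ← Complex.ofReal_pow]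
        generalize p ^ 2 = u
        generalize q ^ 2 = v
        simp
      rw [this]
      rcases hη with rfl | rfl
      · rw [abs_le, abs_of_pos (by linarith)]; constructor <;> linarith
      · rw [mul_neg_one, ← sub_eq_add_neg]
    have hre0 : 0 ≤ ζ.re := by rw [hre]; positivity
    have h1 := add_abs_le_two_mul_norm ζ hre0
    have h2 := hG ζ hre0 (S p q) (hS p q) ((hS2 p q).trans (by linarith))
    calc _ ≤ 2 * Real.sqrt (1 + p ^ 2) * (2 * Real.sqrt (1 + q ^ 2)) *
          (C₁ * S p q ^ (-4 + δ)) := by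
          have := hS p q
          gcongr
          · exact norm_hankelDerivAmp_le p
          · exact hm2 q
      _ = 4 * C₁ * (Real.sqrt (1 + p ^ 2) * Real.sqrt (1 + q ^ 2) * S p q ^ (-4 + δ)) := by ring
      _ ≤ 4 * C₁ * (b p * c q) := mul_le_mul_of_nonneg_left (hbc p q) (by positivity)
      _ = _ := by ring

/-- The bound with the trigonometric form of `J₀'`, used away from the region where both
arguments are large and comparable. -/
lemma norm_integral_exp_mul_sin_le {δ C₀ C₁ : ℝ} (hδ : 0 < δ) {f : ℝ → ℂ} (hf : Measurable f)
    (hf0 : ∀ t : ℝ, 0 < t → ‖f t‖ ≤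
      (Set.Ioc 0 1).indicator (fun t : ℝ => C₀ * t ^ (5 / 2 : ℝ)) t)
    (hC₁ : 0 ≤ C₁)
    (hG : ∀ ζ : ℂ, 0 ≤ ζ.re → ∀ S : ℝ, 0 < S → S ≤ 18 * (1 + ‖ζ‖) →
      ‖∫ t in Set.Ioi (0:ℝ), Complex.exp (-(t * ζ)) * f t‖ ≤ C₁ * S ^ (-4 + δ))
    {r s : ℝ} (hr : 0 < r) (hs : 0 < s) (hrs : s ≤ r / 2 ∨ r ≤ 4 ∧ s ≤ 4) (hδ2 : δ < 1 / 2) :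
    ‖∫ t in Set.Ioi (0:ℝ), f t *
      ((∫ p in Set.Ioi (0:ℝ), hankelDerivAmp p *
        Complex.exp (-(t * (r * ((p:ℂ) ^ 2 + (1:ℝ) * Complex.I))))) *
      ∫ θ in Set.Ioc (-Real.pi) Real.pi, Complex.I * Real.sin θ / (2 * Real.pi) *
        Complex.exp (-(t * (s * -(Complex.I * Real.sin θ)))))‖ ≤
      (4 * Real.pi * C₁ * ∫ p in Set.Ioi (0:ℝ), (1 + p ^ 2) ^ (-((1 + δ) / 2))) *
        (r⁻¹ * (1 + r + s) ^ (-3 + 2 * δ)) := by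
  have hI : IntegrableOn (fun p : ℝ => (1 + p ^ 2)⁻¹) (Set.Ioi 0) :=
    integrable_inv_one_add_sq.integrableOn
  obtain ⟨hg, hg'⟩ := integrableOn_one_add_mul_sq_rpow hδ hr
  have hpi := Real.pi_pos
  have hm : ∀ θ : ℝ, ‖Complex.I * Real.sin θ / (2 * Real.pi)‖ ≤ 1 := fun θ => by
    rw [norm_div, norm_mul, norm_mul, Complex.norm_I, Complex.norm_real, Complex.norm_real,
      Real.norm_eq_abs, Real.norm_eq_abs, abs_of_pos hpi, div_le_one (by simp [hpi])]
    have := Real.abs_sin_le_one θ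
    have := Real.pi_gt_three
    simp
    linarith
  set T := 1 + r + s with hT
  have hT1 : 1 ≤ T := by linarith
  have key := norm_integral_mul_integral_mul_integral_le
    (μ := volume.restrict (Set.Ioi 0)) (ν := volume.restrict (Set.Ioc (-Real.pi) Real.pi)) hf
    (k := hankelDerivAmp) (φ := fun p => r * ((p:ℂ) ^ 2 + (1:ℝ) * Complex.I))
    (m := fun θ => Complex.I * Real.sin θ / (2 * Real.pi))
    (σ := fun θ => s * -(Complex.I * Real.sin θ))
    continuous_hankelDerivAmp.measurable (by fun_prop) (by fun_prop) (by fun_prop)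
    ((hI.const_mul (3 * (min 1 r) ^ (-(3 / 2) : ℝ))).const_mul 2)
    (B := fun _ => 1) (by simp)
    (integrableOn_indicator_rpow C₀ (by norm_num : (-1:ℝ) < -(1 / 2)))
    (fun t ht p θ => norm_mul_mul_le_indicator ht (hf0 t ht)
      (fun h => norm_mul_exp_neg_mul_sq_add_le (norm_hankelDerivAmp_le p) hr ht h)
      (fun h => ?_))
    (hg.const_mul (2 * C₁ * ((Real.sqrt r)⁻¹ * T ^ (-3 + 2 * δ)))) (c := fun _ => 1) (by simp) ?_
  · refine key.2.trans_eq ?_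
    rw [integral_const_mul, hg', integral_const]
    have e : (Real.sqrt r)⁻¹ * (Real.sqrt r)⁻¹ = r⁻¹ := by
      rw [← mul_inv, Real.mul_self_sqrt hr.le]
    simp only [smul_eq_mul, mul_one, measureReal_restrict_apply MeasurableSet.univ, Set.univ_inter,
      Real.volume_real_Ioc_of_le (by linarith : -Real.pi ≤ Real.pi)]
    rw [← e]
    ring
  · have h1 : 1 ≤ t ^ (-(3 / 2) : ℝ) :=
      Real.one_le_rpow_of_pos_of_le_one_of_nonpos ht h (by norm_num)
    rw [norm_mul, Complex.norm_exp, show -((t:ℂ) * (s * -(Complex.I * Real.sin θ))) =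
      ((t * s * Real.sin θ : ℝ) : ℂ) * Complex.I by push_cast; ring, Complex.re_ofReal_mul,
      Complex.I_re, mul_zero, Real.exp_zero]
    linarith [hm θ]
  · intro p θ
    set ζ : ℂ := r * ((p:ℂ) ^ 2 + (1:ℝ) * Complex.I) + s * -(Complex.I * Real.sin θ) with hζ
    have hre : ζ.re = r * p ^ 2 := by
      rw [hζ, ← Complex.ofReal_pow]
      generalize p ^ 2 = u
      generalize Real.sin θ = v
      simp
    have him : ζ.im = r - s * Real.sin θ := by
      rw [hζ, ← Complex.ofReal_pow]
      generalize p ^ 2 = u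
      generalize Real.sin θ = v
      simp
      ring
    have hp0 : 0 ≤ r * p ^ 2 := by positivity
    have h1 := add_abs_le_two_mul_norm ζ (by rw [hre]; exact hp0)
    rw [hre, him] at h1
    have h2 : T + r * p ^ 2 ≤ 18 * (1 + ‖ζ‖) := by
      rcases hrs with h | h
      · have h3 := le_abs_self (r - s * Real.sin θ)
        have h4 : s * Real.sin θ ≤ s := mul_le_of_le_one_right hs.le (Real.sin_le_one θ)
        linarith
      · have h3 := abs_nonneg (r - s * Real.sin θ)
        linarith [h.1, h.2]
    have h3 := hG ζ (by rw [hre]; exact hp0) (T + r * p ^ 2) (by linarith) h2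
    set S := T + r * p ^ 2 with hS
    have hS0 : 0 < S := by linarith
    have h5 : Real.sqrt (1 + p ^ 2) ≤ (Real.sqrt r)⁻¹ * S ^ (1 / 2 : ℝ) := by
      rw [← Real.sqrt_eq_rpow, ← Real.sqrt_inv, ← Real.sqrt_mul (by positivity)]
      refine Real.sqrt_le_sqrt ?_
      rw [inv_mul_eq_div, le_div_iff₀ hr]
      nlinarith
    have h6 : S ^ (-((1 + δ) / 2)) ≤ (1 + r * p ^ 2) ^ (-((1 + δ) / 2)) :=
      Real.rpow_le_rpow_of_nonpos (by positivity) (by linarith) (by linarith)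
    have h7 : S ^ (-3 + 3 * δ / 2) ≤ T ^ (-3 + 2 * δ) :=
      (Real.rpow_le_rpow_of_nonpos (by positivity) (by linarith) (by linarith)).trans
        (Real.rpow_le_rpow_of_exponent_le hT1 (by linarith))
    have h8 : S ^ (1 / 2 : ℝ) * S ^ (-4 + δ) = S ^ (-((1 + δ) / 2)) * S ^ (-3 + 3 * δ / 2) := by
      rw [← Real.rpow_add hS0, ← Real.rpow_add hS0]; congr 1; ring
    calc _ ≤ 2 * ((Real.sqrt r)⁻¹ * S ^ (1 / 2 : ℝ)) * 1 * (C₁ * S ^ (-4 + δ)) := by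
          gcongr
          · exact (norm_hankelDerivAmp_le p).trans (by gcongr)
          · exact hm θ
      _ = 2 * C₁ * ((Real.sqrt r)⁻¹ * (S ^ (1 / 2 : ℝ) * S ^ (-4 + δ))) := by ring
      _ = 2 * C₁ * ((Real.sqrt r)⁻¹ * (S ^ (-((1 + δ) / 2)) * S ^ (-3 + 3 * δ / 2))) := by rw [h8]
      _ ≤ 2 * C₁ * ((Real.sqrt r)⁻¹ * ((1 + r * p ^ 2) ^ (-((1 + δ) / 2)) *
          T ^ (-3 + 2 * δ))) := by gcongr
      _ = _ := by ring

/-- Pointwise bound when the second argument dominates. -/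
lemma sqrt_mul_sqrt_mul_rpow_le_of_le {δ r s : ℝ} (hδ : 0 < δ) (hδ2 : δ < 1 / 2) (hr : 0 < r)
    (hs : 0 < s) (hrs : r ≤ s / 2) (p q : ℝ) :
    Real.sqrt (1 + p ^ 2) * Real.sqrt (1 + q ^ 2) *
      (1 + s + r * p ^ 2 + s * q ^ 2) ^ (-4 + δ) ≤
      (Real.sqrt r)⁻¹ * (Real.sqrt s)⁻¹ * (1 + s) ^ (-2 + 2 * δ) *
        (1 + r * p ^ 2) ^ (-((1 + δ) / 2)) * (1 + s * q ^ 2) ^ (-((1 + δ) / 2)) := by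
  have hp0 : 0 ≤ r * p ^ 2 := by positivity
  have hq0 : 0 ≤ s * q ^ 2 := by positivity
  set S := 1 + s + r * p ^ 2 + s * q ^ 2 with hS
  have hS0 : 0 < S := by linarith
  have h5 : Real.sqrt (1 + p ^ 2) ≤ (Real.sqrt r)⁻¹ * S ^ (1 / 2 : ℝ) := by
    rw [← Real.sqrt_eq_rpow, ← Real.sqrt_inv, ← Real.sqrt_mul (by positivity)]
    refine Real.sqrt_le_sqrt ?_
    rw [inv_mul_eq_div, le_div_iff₀ hr]
    nlinarith
  have h6 : Real.sqrt (1 + q ^ 2) ≤ (Real.sqrt s)⁻¹ * S ^ (1 / 2 : ℝ) := by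
    rw [← Real.sqrt_eq_rpow, ← Real.sqrt_inv, ← Real.sqrt_mul (by positivity)]
    refine Real.sqrt_le_sqrt ?_
    rw [inv_mul_eq_div, le_div_iff₀ hs]
    nlinarith
  have h7 : S ^ (-((1 + δ) / 2)) ≤ (1 + r * p ^ 2) ^ (-((1 + δ) / 2)) :=
    Real.rpow_le_rpow_of_nonpos (by positivity) (by linarith) (by linarith)
  have h8 : S ^ (-((1 + δ) / 2)) ≤ (1 + s * q ^ 2) ^ (-((1 + δ) / 2)) :=
    Real.rpow_le_rpow_of_nonpos (by positivity) (by linarith) (by linarith)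
  have h9 : S ^ (-2 + 2 * δ) ≤ (1 + s) ^ (-2 + 2 * δ) :=
    Real.rpow_le_rpow_of_nonpos (by positivity) (by linarith) (by linarith)
  have h10 : S ^ (1 / 2 : ℝ) * S ^ (1 / 2 : ℝ) * S ^ (-4 + δ) =
      S ^ (-2 + 2 * δ) * S ^ (-((1 + δ) / 2)) * S ^ (-((1 + δ) / 2)) := by
    rw [← Real.rpow_add hS0, ← Real.rpow_add hS0, ← Real.rpow_add hS0, ← Real.rpow_add hS0]
    congr 1; ring
  calc _ ≤ (Real.sqrt r)⁻¹ * S ^ (1 / 2 : ℝ) * ((Real.sqrt s)⁻¹ * S ^ (1 / 2 : ℝ)) *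
        S ^ (-4 + δ) := by gcongr
    _ = (Real.sqrt r)⁻¹ * (Real.sqrt s)⁻¹ * (S ^ (1 / 2 : ℝ) * S ^ (1 / 2 : ℝ) *
        S ^ (-4 + δ)) := by ring
    _ = (Real.sqrt r)⁻¹ * (Real.sqrt s)⁻¹ * S ^ (-2 + 2 * δ) * S ^ (-((1 + δ) / 2)) *
        S ^ (-((1 + δ) / 2)) := by rw [h10]; ring
    _ ≤ _ := by gcongr

lemma sqrt_mul_le_of_le {r p D S : ℝ} (hD0 : 0 ≤ D) (hD : D ≤ r) (hr : 1 ≤ r)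
    (hS : 1 + D + r * p ^ 2 ≤ S) :
    Real.sqrt (1 + p ^ 2) * (1 + D) ≤ S := by
  have hp := sq_nonneg p
  have hp0 : 0 ≤ r * p ^ 2 := by positivity
  refine le_trans ?_ hS
  rw [← Real.sqrt_sq (by linarith : 0 ≤ 1 + D), ← Real.sqrt_mul (by positivity)]
  refine Real.sqrt_le_iff.2 ⟨by rw [Real.sqrt_sq (by linarith)]; positivity, ?_⟩
  rw [Real.sqrt_sq (by linarith)]
  have h1 : (1 + D) ^ 2 ≤ 2 * (1 + D) * r := by nlinarith
  nlinarith [mul_le_mul_of_nonneg_right h1 hp]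

/-- Pointwise bound when the two arguments are large and comparable. -/
lemma sqrt_mul_sqrt_mul_rpow_le_of_near {δ r s D : ℝ} (hδ : 0 < δ) (hδ2 : δ < 1 / 2) (hr : 1 ≤ r)
    (hs : 1 ≤ s) (hD0 : 0 ≤ D) (hDr : D ≤ r) (hDs : D ≤ s) (p q : ℝ) :
    Real.sqrt (1 + p ^ 2) * Real.sqrt (1 + q ^ 2) *
      (1 + D + r * p ^ 2 + s * q ^ 2) ^ (-4 + δ) ≤
      ((1 + D) ^ 2)⁻¹ *
        (1 + r * p ^ 2) ^ (-((1 + δ) / 2)) * (1 + s * q ^ 2) ^ (-((1 + δ) / 2)) := by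
  have hp0 : 0 ≤ r * p ^ 2 := by positivity
  have hq0 : 0 ≤ s * q ^ 2 := by positivity
  set S := 1 + D + r * p ^ 2 + s * q ^ 2 with hS
  have hS1 : 1 ≤ S := by linarith
  have hS0 : 0 < S := by linarith
  have h5 := sqrt_mul_le_of_le hD0 hDr hr (by linarith : 1 + D + r * p ^ 2 ≤ S)
  have h6 := sqrt_mul_le_of_le hD0 hDs hs (by linarith : 1 + D + s * q ^ 2 ≤ S)
  have hDpos : 0 < 1 + D := by linarith
  rw [← le_div_iff₀ hDpos] at h5 h6
  have h7 : S ^ (-((1 + δ) / 2)) ≤ (1 + r * p ^ 2) ^ (-((1 + δ) / 2)) :=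
    Real.rpow_le_rpow_of_nonpos (by positivity) (by linarith) (by linarith)
  have h8 : S ^ (-((1 + δ) / 2)) ≤ (1 + s * q ^ 2) ^ (-((1 + δ) / 2)) :=
    Real.rpow_le_rpow_of_nonpos (by positivity) (by linarith) (by linarith)
  have h10 : S * S * S ^ (-4 + δ) ≤ S ^ (-((1 + δ) / 2)) * S ^ (-((1 + δ) / 2)) := by
    rw [← pow_two, ← Real.rpow_natCast, ← Real.rpow_add hS0, ← Real.rpow_add hS0]
    refine Real.rpow_le_rpow_of_exponent_le hS1 ?_
    push_cast
    linarith
  calc _ ≤ S / (1 + D) * (S / (1 + D)) * S ^ (-4 + δ) := by gcongr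
    _ = ((1 + D) ^ 2)⁻¹ * (S * S * S ^ (-4 + δ)) := by field_simp
    _ ≤ ((1 + D) ^ 2)⁻¹ * (S ^ (-((1 + δ) / 2)) * S ^ (-((1 + δ) / 2))) := by gcongr
    _ = ((1 + D) ^ 2)⁻¹ * S ^ (-((1 + δ) / 2)) * S ^ (-((1 + δ) / 2)) := by ring
    _ ≤ _ := by gcongr

section Hankel

variable {Y0 : ℝ → ℝ} {H0m : ℝ → ℂ}

lemma hasDerivAt_hankel
    (hY0 : ∀ z : ℝ, 0 < z →
      Tendsto (fun T : ℝ => ∫ t in (0:ℝ)..T, Real.cos (z * Real.cosh t)) atTop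
        (nhds (-(Real.pi / 2) * Y0 z)))
    (hH0m : ∀ z : ℝ, 0 < z → H0m z = (J0 z : ℂ) - Complex.I * (Y0 z : ℂ)) {z : ℝ} (hz : 0 < z) :
    HasDerivAt H0m
      (∫ p in Set.Ioi (0:ℝ),
        hankelDerivAmp p * Complex.exp (-(z * ((p:ℂ) ^ 2 + Complex.I)))) z := by
  refine (hasDerivAt_integral_hankelAmp hz).congr_of_eventuallyEq ?_
  filter_upwards [Ioi_mem_nhds hz] with y hy
  rw [hH0m y hy, hankel_eq_integral hy (hY0 y hy)]

lemma deriv_hankel_mul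
    (hY0 : ∀ z : ℝ, 0 < z →
      Tendsto (fun T : ℝ => ∫ t in (0:ℝ)..T, Real.cos (z * Real.cosh t)) atTop
        (nhds (-(Real.pi / 2) * Y0 z)))
    (hH0m : ∀ z : ℝ, 0 < z → H0m z = (J0 z : ℂ) - Complex.I * (Y0 z : ℂ))
    {t r : ℝ} (ht : 0 < t) (hr : 0 < r) :
    deriv H0m (t * r) = ∫ p in Set.Ioi (0:ℝ), hankelDerivAmp p *
        Complex.exp (-(t * (r * ((p:ℂ) ^ 2 + (1:ℝ) * Complex.I)))) := by
  rw [(hasDerivAt_hankel hY0 hH0m (mul_pos ht hr)).deriv]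
  push_cast
  simp only [one_mul, mul_assoc]

lemma deriv_J0_mul
    (hY0 : ∀ z : ℝ, 0 < z →
      Tendsto (fun T : ℝ => ∫ t in (0:ℝ)..T, Real.cos (z * Real.cosh t)) atTop
        (nhds (-(Real.pi / 2) * Y0 z)))
    (hH0m : ∀ z : ℝ, 0 < z → H0m z = (J0 z : ℂ) - Complex.I * (Y0 z : ℂ))
    {t s : ℝ} (ht : 0 < t) (hs : 0 < s) :
    ((deriv J0 (t * s) : ℝ) : ℂ) = ((∫ q in Set.Ioi (0:ℝ), hankelDerivAmp q *
        Complex.exp (-(t * (s * ((q:ℂ) ^ 2 + (1:ℝ) * Complex.I))))) +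
      ∫ q in Set.Ioi (0:ℝ), (starRingEnd ℂ) (hankelDerivAmp q) *
        Complex.exp (-(t * (s * ((q:ℂ) ^ 2 + (-1:ℝ) * Complex.I))))) / 2 := by
  have hz := mul_pos ht hs
  have h1 := hasDerivAt_hankel hY0 hH0m hz
  have h2 := Complex.reCLM.hasFDerivAt.comp_hasDerivAt (t * s) h1
  have h3 : HasDerivAt J0 (∫ p in Set.Ioi (0:ℝ), hankelDerivAmp p *
      Complex.exp (-((t * s : ℝ) * ((p:ℂ) ^ 2 + Complex.I)))).re (t * s) := by
    refine h2.congr_of_eventuallyEq ?_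
    filter_upwards [Ioi_mem_nhds hz] with y hy
    simp [hH0m y hy]
  rw [h3.deriv, Complex.re_eq_add_conj, ← integral_conj]
  congr 2
  · push_cast
    simp only [one_mul, mul_assoc]
  · refine integral_congr_ae (ae_of_all _ fun q => ?_)
    simp only [map_mul, ← Complex.exp_conj, map_neg, map_add, map_pow, Complex.conj_ofReal,
      Complex.conj_I]
    push_cast
    ring_nf

end Hankel

section Laplace

variable {δ C₀ C₁ : ℝ} {f : ℝ → ℂ}

/-- The bound with both factors split into exponentials. -/
lemma norm_integral_exp_mul_add_le (hf : Measurable f)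
    (hf0 : ∀ t : ℝ, 0 < t → ‖f t‖ ≤
      (Set.Ioc 0 1).indicator (fun t : ℝ => C₀ * t ^ (5 / 2 : ℝ)) t)
    (hC₁ : 0 ≤ C₁)
    (hG : ∀ ζ : ℂ, 0 ≤ ζ.re → ∀ S : ℝ, 0 < S → S ≤ 18 * (1 + ‖ζ‖) →
      ‖∫ t in Set.Ioi (0:ℝ), Complex.exp (-(t * ζ)) * f t‖ ≤ C₁ * S ^ (-4 + δ))
    (hδ : 0 < δ) {r s : ℝ} (hr : 0 < r) (hs : 0 < s) {S : ℝ → ℝ → ℝ} (hS : ∀ p q, 0 < S p q)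
    (hS2 : ∀ p q, S p q ≤ 9 * (1 + |r - s| + r * p ^ 2 + s * q ^ 2)) {M : ℝ}
    (hM : ∀ p q : ℝ, Real.sqrt (1 + p ^ 2) * Real.sqrt (1 + q ^ 2) * S p q ^ (-4 + δ) ≤
      M * (1 + r * p ^ 2) ^ (-((1 + δ) / 2)) * (1 + s * q ^ 2) ^ (-((1 + δ) / 2))) :
    ‖∫ t in Set.Ioi (0:ℝ), f t * ((∫ p in Set.Ioi (0:ℝ), hankelDerivAmp p *
        Complex.exp (-(t * (r * ((p:ℂ) ^ 2 + (1:ℝ) * Complex.I))))) *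
      (((∫ q in Set.Ioi (0:ℝ), hankelDerivAmp q *
        Complex.exp (-(t * (s * ((q:ℂ) ^ 2 + (1:ℝ) * Complex.I))))) +
      ∫ q in Set.Ioi (0:ℝ), (starRingEnd ℂ) (hankelDerivAmp q) *
        Complex.exp (-(t * (s * ((q:ℂ) ^ 2 + (-1:ℝ) * Complex.I))))) / 2))‖ ≤
      4 * C₁ * (∫ p in Set.Ioi (0:ℝ), (1 + p ^ 2) ^ (-((1 + δ) / 2))) ^ 2 *
        (M * ((Real.sqrt r)⁻¹ * (Real.sqrt s)⁻¹)) := by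
  obtain ⟨hr1, hr2⟩ := integrableOn_one_add_mul_sq_rpow hδ hr
  obtain ⟨hs1, hs2⟩ := integrableOn_one_add_mul_sq_rpow hδ hs
  set A := ∫ p in Set.Ioi (0:ℝ), (1 + p ^ 2) ^ (-((1 + δ) / 2)) with hA
  obtain ⟨i1, b1⟩ := norm_integral_exp_mul_exp_le hf hf0 hC₁ hG
    continuous_hankelDerivAmp.measurable norm_hankelDerivAmp_le (Or.inl rfl) hr hs hS hS2
    (hr1.const_mul M) hs1 hM
  obtain ⟨i2, b2⟩ := norm_integral_exp_mul_exp_le hf hf0 hC₁ hG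
    (m := fun q => (starRingEnd ℂ) (hankelDerivAmp q))
    (Complex.continuous_conj.comp continuous_hankelDerivAmp).measurable
    (fun q => by rw [RCLike.norm_conj]; exact norm_hankelDerivAmp_le q) (Or.inr rfl) hr hs hS hS2
    (hr1.const_mul M) hs1 hM
  rw [integral_const_mul, hr2, hs2] at b1 b2
  have e : ∀ F x y z : ℂ, F * (x * ((y + z) / 2)) = (1 / 2 : ℂ) * (F * (x * y) + F * (x * z)) :=
    fun F x y z => by ring
  simp only [e]
  rw [integral_const_mul, integral_add i1 i2, norm_mul]
  have h2 : ‖(1 / 2 : ℂ)‖ = 1 / 2 := by simp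
  rw [h2]
  calc _ ≤ 1 / 2 * (4 * C₁ * (M * ((Real.sqrt r)⁻¹ * A) * ((Real.sqrt s)⁻¹ * A)) +
        4 * C₁ * (M * ((Real.sqrt r)⁻¹ * A) * ((Real.sqrt s)⁻¹ * A))) := by
        gcongr
        exact (norm_add_le _ _).trans (add_le_add b1 b2)
    _ = _ := by ring

end Laplace

lemma rpow_neg_le_one_div_sqrt {ε r s T : ℝ} (hε : 0 < ε) (hε1 : ε < 1) (hr : 0 < r) (hs : 0 < s)
    (hT : 1 + r + s ≤ T) :
    T ^ (-(2 + ε)) ≤ 1 / Real.sqrt (1 + (r + s) ^ 2) ^ (2 + ε) := by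
  have h0 : 0 < Real.sqrt (1 + (r + s) ^ 2) := by positivity
  have h1 : Real.sqrt (1 + (r + s) ^ 2) ≤ T := by
    refine Real.sqrt_le_iff.2 ⟨by linarith, ?_⟩
    nlinarith [mul_pos hr hs]
  rw [one_div, ← Real.rpow_neg h0.le]
  exact Real.rpow_le_rpow_of_nonpos h0 h1 (by linarith)

/-- the oscillatory integral bound
`|∫₀^∞ (H₀⁻)′(λr) J₀′(λs) λ³ h⁻(λ) χ(λ) dλ| ≲ 1/(√(rs)⟨r-s⟩²) + 1/(r⟨r+s⟩^{2+ε})`.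
Here `Y0` is the Bessel function of the second kind of order zero, characterized by
the improper-integral representation `Y₀(z) = -(2/π) ∫₀^∞ cos(z cosh t) dt` for `z > 0`,
`H0m = J₀ - i Y₀` on `(0,∞)` is the Hankel function, and `h⁻(λ) = a log λ + w`. -/
theorem stmt_3
    (Y0 : ℝ → ℝ)
    (hY0 : ∀ z : ℝ, 0 < z →
      Tendsto (fun T : ℝ => ∫ t in (0:ℝ)..T, Real.cos (z * Real.cosh t)) atTop
        (nhds (-(Real.pi / 2) * Y0 z)))
    (H0m : ℝ → ℂ)
    (hH0m : ∀ z : ℝ, 0 < z → H0m z = (J0 z : ℂ) - Complex.I * (Y0 z : ℂ))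
    (lam₁ : ℝ) (hlam₁ : lam₁ ∈ Set.Ioc (0:ℝ) (1/4))
    (χ : ℝ → ℝ) (hχ : ContDiff ℝ (⊤ : ℕ∞) χ)
    (hχ01 : ∀ t, χ t ∈ Set.Icc (0:ℝ) 1)
    (hχ1 : ∀ t ∈ Set.Icc (0:ℝ) lam₁, χ t = 1)
    (hχ0 : ∀ t : ℝ, 2 * lam₁ ≤ t → χ t = 0)
    (a : ℝ) (ha : a ≠ 0) (w : ℂ)
    (ε : ℝ) (hε : ε ∈ Set.Ioo (0:ℝ) 1) :
    ∃ C : ℝ, 0 < C ∧ ∀ r s : ℝ, 0 < r → 0 < s →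
      ‖∫ l in Set.Ioi (0:ℝ),
          deriv H0m (l * r) * (Complex.ofReal (deriv J0 (l * s))) * (l : ℂ) ^ 3 *
            ((a * Real.log l : ℝ) + w) * (χ l : ℂ)‖ ≤
        C * (1 / (Real.sqrt (r * s) * (1 + (r - s) ^ 2)) +
             1 / (r * Real.sqrt (1 + (r + s) ^ 2) ^ (2 + ε))) := by
  obtain ⟨hε0, hε1⟩ := hε
  set δ := (1 - ε) / 2 with hδ
  have hδ0 : 0 < δ := by linarith
  have hδ2 : δ < 1 / 2 := by linarith
  have hχc : ContDiff ℝ (⊤ : ℕ∞) (fun t => (χ t : ℂ)) := Complex.ofRealCLM.contDiff.comp hχ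
  have hα : ContDiff ℝ (⊤ : ℕ∞) (fun t => (a : ℂ) * (χ t : ℂ)) := contDiff_const.mul hχc
  have hβ : ContDiff ℝ (⊤ : ℕ∞) (fun t => w * (χ t : ℂ)) := contDiff_const.mul hχc
  have hvan : ∀ t, 1 < t → χ t = 0 := fun t ht => hχ0 t (by linarith [hlam₁.2])
  have hα0 : ∀ t, 1 < t → (a : ℂ) * (χ t : ℂ) = 0 := fun t ht => by simp [hvan t ht]
  have hβ0 : ∀ t, 1 < t → w * (χ t : ℂ) = 0 := fun t ht => by simp [hvan t ht]
  obtain ⟨C₀, hC₀, hf0⟩ := exists_norm_cube_mul_log_add_le hα.continuous hβ.continuous hα0 hβ0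
  obtain ⟨C₁, hC₁, hG⟩ := exists_norm_laplace_log_le_rpow hδ0 (by linarith) hα hβ hα0 hβ0
  set f : ℝ → ℂ := fun t => (t : ℂ) ^ 3 * ((a : ℂ) * (χ t : ℂ) * (Real.log t : ℂ) + w * (χ t : ℂ))
    with hf
  have hχm : Measurable χ := hχ.continuous.measurable
  have hfm : Measurable f := by fun_prop
  set A := ∫ p in Set.Ioi (0:ℝ), (1 + p ^ 2) ^ (-((1 + δ) / 2)) with hA
  have hA0 : 0 ≤ A := setIntegral_nonneg measurableSet_Ioi fun p _ => by positivity
  have hexp : -3 + 2 * δ = -(2 + ε) := by rw [hδ]; ring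
  refine ⟨4 * Real.pi * C₁ * A + 64 * C₁ * A ^ 2 + 1, by positivity, fun r s hr hs => ?_⟩
  have e1 : ∀ t : ℝ, deriv H0m (t * r) * (Complex.ofReal (deriv J0 (t * s))) * (t : ℂ) ^ 3 *
      ((a * Real.log t : ℝ) + w) * (χ t : ℂ) =
      f t * (deriv H0m (t * r) * (Complex.ofReal (deriv J0 (t * s)))) := fun t => by
    simp only [hf]; push_cast; ring
  set P := 1 / (Real.sqrt (r * s) * (1 + (r - s) ^ 2)) with hP
  set Q := 1 / (r * Real.sqrt (1 + (r + s) ^ 2) ^ (2 + ε)) with hQ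
  have hP0 : 0 ≤ P := by positivity
  have hQ0 : 0 ≤ Q := by positivity
  have hQ' : r⁻¹ * (1 / Real.sqrt (1 + (r + s) ^ 2) ^ (2 + ε)) = Q := by
    rw [hQ]; field_simp
  by_cases hcase : s ≤ r / 2 ∨ r ≤ 4 ∧ s ≤ 4
  · rw [setIntegral_congr_fun measurableSet_Ioi (g := fun t : ℝ => f t *
      ((∫ p in Set.Ioi (0:ℝ), hankelDerivAmp p *
        Complex.exp (-(t * (r * ((p:ℂ) ^ 2 + (1:ℝ) * Complex.I))))) *
      ∫ θ in Set.Ioc (-Real.pi) Real.pi, Complex.I * Real.sin θ / (2 * Real.pi) *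
        Complex.exp (-(t * (s * -(Complex.I * Real.sin θ))))))
      (fun t ht => by
        rw [e1, deriv_hankel_mul hY0 hH0m ht hr, deriv_J0_eq_integral_exp]
        push_cast
        simp only [mul_assoc])]
    refine (norm_integral_exp_mul_sin_le hδ0 hfm hf0 hC₁ hG hr hs hcase hδ2).trans ?_
    rw [hexp]
    have h := rpow_neg_le_one_div_sqrt hε0 hε1 hr hs le_rfl
    have h' : r⁻¹ * (1 + r + s) ^ (-(2 + ε)) ≤ Q := by
      rw [← hQ']; gcongr
    calc _ ≤ 4 * Real.pi * C₁ * A * Q := by gcongr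
      _ ≤ (4 * Real.pi * C₁ * A + 64 * C₁ * A ^ 2 + 1) * (P + Q) := by
        gcongr
        · have : 0 ≤ 64 * C₁ * A ^ 2 := by positivity
          linarith
        · linarith
  · rw [setIntegral_congr_fun measurableSet_Ioi
      (fun t ht => by
        rw [e1, deriv_hankel_mul hY0 hH0m ht hr, deriv_J0_mul hY0 hH0m ht hs])]
    push Not at hcase
    obtain ⟨hc1, hc2⟩ := hcase
    have hfin : ∀ X : ℝ, 0 ≤ X → X ≤ 16 * (P + Q) → 4 * C₁ * A ^ 2 * X ≤
        (4 * Real.pi * C₁ * A + 64 * C₁ * A ^ 2 + 1) * (P + Q) := fun X hX0 hX => by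
      have h1 : 0 ≤ 4 * Real.pi * C₁ * A := by positivity
      calc _ ≤ 4 * C₁ * A ^ 2 * (16 * (P + Q)) := by gcongr
        _ = (64 * C₁ * A ^ 2) * (P + Q) := by ring
        _ ≤ _ := by gcongr; linarith
    rcases le_or_gt r (s / 2) with h | h
    · have hs1 : 1 ≤ s := by
        by_contra! h1
        linarith [hc2 (by linarith)]
      have hab : s / 2 ≤ |r - s| := by
        rw [abs_sub_comm]; exact (by linarith : s / 2 ≤ s - r).trans (le_abs_self _)
      refine (norm_integral_exp_mul_add_le hfm hf0 hC₁ hG hδ0 hr hs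
        (S := fun p q => 1 + s + r * p ^ 2 + s * q ^ 2) (fun p q => by positivity)
        (fun p q => ?_) (fun p q => sqrt_mul_sqrt_mul_rpow_le_of_le hδ0 hδ2 hr hs h p q)).trans
        (hfin _ (by positivity) ?_)
      · have hp0 : 0 ≤ r * p ^ 2 := by positivity
        have hq0 : 0 ≤ s * q ^ 2 := by positivity
        linarith
      · have h1 := rpow_neg_le_one_div_sqrt hε0 hε1 hr hs (T := 2 * (1 + s)) (by linarith)
        have hs0 : 0 < 1 + s := by linarith
        rw [Real.mul_rpow (by norm_num) hs0.le] at h1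
        have h2 : (1 / 8 : ℝ) ≤ 2 ^ (-(2 + ε)) := by
          calc (1 / 8 : ℝ) = 2 ^ (-3 : ℝ) := by
                rw [Real.rpow_neg (by norm_num)]; norm_num
            _ ≤ _ := Real.rpow_le_rpow_of_exponent_le (by norm_num) (by linarith)
        have h3 : (1 + s) ^ (-2 + 2 * δ) = (1 + s) * (1 + s) ^ (-(2 + ε)) := by
          rw [← Real.rpow_one_add' hs0.le (by linarith)]
          congr 1
          rw [hδ]; ring
        have h4 : (1 + s) * s⁻¹ ≤ 2 := by
          rw [← div_eq_mul_inv, div_le_iff₀ hs]; linarith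
        have e : ∀ x : ℝ, 0 < x → (Real.sqrt x)⁻¹ * (Real.sqrt x)⁻¹ = x⁻¹ := fun x hx => by
          rw [← mul_inv, Real.mul_self_sqrt hx.le]
        have h5 : (1 + s) ^ (-(2 + ε)) ≤ 8 * (1 / Real.sqrt (1 + (r + s) ^ 2) ^ (2 + ε)) := by
          have hpos : 0 < (1 + s) ^ (-(2 + ε)) := by positivity
          nlinarith [mul_le_mul_of_nonneg_right h2 hpos.le]
        calc _ = (Real.sqrt r)⁻¹ * (Real.sqrt r)⁻¹ * ((1 + s) *
              ((Real.sqrt s)⁻¹ * (Real.sqrt s)⁻¹)) * (1 + s) ^ (-(2 + ε)) := by rw [h3]; ring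
          _ = r⁻¹ * ((1 + s) * s⁻¹) * (1 + s) ^ (-(2 + ε)) := by rw [e r hr, e s hs]
          _ ≤ r⁻¹ * 2 * (8 * (1 / Real.sqrt (1 + (r + s) ^ 2) ^ (2 + ε))) := by gcongr
          _ = 16 * Q := by rw [← hQ']; ring
          _ ≤ _ := by linarith
    · have hr1 : 1 ≤ r := by
        by_contra! h1
        linarith [hc2 (by linarith)]
      have hs1 : 1 ≤ s := by
        by_contra! h1
        linarith [hc2 (by linarith)]
      have hD0 := abs_nonneg (r - s)
      have hDr : |r - s| ≤ r := by rw [abs_le]; constructor <;> linarith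
      have hDs : |r - s| ≤ s := by rw [abs_le]; constructor <;> linarith
      refine (norm_integral_exp_mul_add_le hfm hf0 hC₁ hG hδ0 hr hs
        (S := fun p q => 1 + |r - s| + r * p ^ 2 + s * q ^ 2) (fun p q => by positivity)
        (fun p q => ?_)
        (fun p q => sqrt_mul_sqrt_mul_rpow_le_of_near hδ0 hδ2 hr1 hs1 hD0 hDr hDs p q)).trans
        (hfin _ (by positivity) ?_)
      · have : 0 < 1 + |r - s| + r * p ^ 2 + s * q ^ 2 := by positivity
        linarith
      · have h1 : ((1 + |r - s|) ^ 2)⁻¹ ≤ (1 + (r - s) ^ 2)⁻¹ := by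
          refine inv_anti₀ (by positivity) ?_
          rw [← sq_abs (r - s)]
          nlinarith
        calc _ ≤ (1 + (r - s) ^ 2)⁻¹ * ((Real.sqrt r)⁻¹ * (Real.sqrt s)⁻¹) := by gcongr
          _ = P := by rw [hP, Real.sqrt_mul hr.le]; field_simp
          _ ≤ _ := by linarith
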